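/- Let Ω be an open ball or annulus centered at the origin in ℝ^N, N ≥ 2, and let U ∈ C²(Ω;ℝ^m) ∩ C¹(Ω̄;ℝ^m) be a classical solution of −Δu_i = f_i(|x|,U) in Ω, u_i = 0 on ∂Ω (i = 1,…,m). If U is linearized stable and the system is fully coupled along U in Ω, then U is radial, i.e. U(x) depends only on |x|. -/

import Mathlib

open MeasureTheory Real Set
open scoped RealInnerProductSpace ENNReal

noncomputable section

/-- Euclidean space `ℝ^N`. -/
abbrev EuclN (N : ℕ) := EuclideanSpace ℝ (Fin N)

/-- The Laplacian of a scalar function on `ℝ^N`. -/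
def lap {N : ℕ} (u : EuclN N → ℝ) (x : EuclN N) : ℝ :=
  ∑ i : Fin N, iteratedFDeriv ℝ 2 u x ![EuclideanSpace.single i 1, EuclideanSpace.single i 1]

/-- Partial derivative `∂f/∂u_j` of `f(r, u)` with respect to the `j`-th `u`-variable. -/
def pd {m : ℕ} (f : ℝ → (Fin m → ℝ) → ℝ) (j : Fin m) (r : ℝ) (s : Fin m → ℝ) : ℝ :=
  fderiv ℝ (f r) s (Pi.single j 1)

/-- `Ψ ∈ C^1_c(Ω'; ℝ^m)`. -/
def IsTestFun {N m : ℕ} (Ω' : Set (EuclN N)) (Ψ : Fin m → EuclN N → ℝ) : Prop :=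
  ∀ i, ContDiff ℝ 1 (Ψ i) ∧ HasCompactSupport (Ψ i) ∧ tsupport (Ψ i) ⊆ Ω'

/-- The quadratic form `Q_U(Ψ; Ω')` of the linearized operator at a solution `U`. -/
def Qform {N m : ℕ} (f : Fin m → ℝ → (Fin m → ℝ) → ℝ) (U : Fin m → EuclN N → ℝ)
    (Ω' : Set (EuclN N)) (Ψ : Fin m → EuclN N → ℝ) : ℝ :=
  ∫ x in Ω', ((∑ i, ‖gradient (Ψ i) x‖ ^ 2) -
    ∑ i, ∑ j, pd (f i) j ‖x‖ (fun k => U k x) * Ψ i x * Ψ j x)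

/-- There is a `k`-dimensional subspace of `C^1_c(Ω'; ℝ^m)` on which `Q_U(·; Ω')`
is negative definite. -/
def NegDefFamily {N m : ℕ} (f : Fin m → ℝ → (Fin m → ℝ) → ℝ) (U : Fin m → EuclN N → ℝ)
    (Ω' : Set (EuclN N)) (k : ℕ) : Prop :=
  ∃ Ψ : Fin k → Fin m → EuclN N → ℝ,
    (∀ l, IsTestFun Ω' (Ψ l)) ∧
    ∀ c : Fin k → ℝ, c ≠ 0 → Qform f U Ω' (fun i x => ∑ l, c l * Ψ l i x) < 0

/-- The semilinear system is cooperative (weakly coupled) in `Ω'`. -/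
def CoopAlong {N m : ℕ} (f : Fin m → ℝ → (Fin m → ℝ) → ℝ) (Ω' : Set (EuclN N)) : Prop :=
  ∀ i j, i ≠ j → ∀ x ∈ Ω', ∀ s : Fin m → ℝ, 0 ≤ pd (f i) j ‖x‖ s

/-- The semilinear system is fully coupled along the solution `U` in `Ω'`. -/
def FullyCoupledAlong {N m : ℕ} (f : Fin m → ℝ → (Fin m → ℝ) → ℝ)
    (U : Fin m → EuclN N → ℝ) (Ω' : Set (EuclN N)) : Prop :=
  CoopAlong f Ω' ∧
  ∀ I J : Finset (Fin m), I.Nonempty → J.Nonempty → Disjoint I J → I ∪ J = Finset.univ →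
    ∃ i₀ ∈ I, ∃ j₀ ∈ J,
      0 < volume {x ∈ Ω' | 0 < pd (f i₀) j₀ ‖x‖ (fun k => U k x)}

/-- `Ω` is an open ball or annulus centered at the origin. -/
def IsBallOrAnnulus {N : ℕ} (Ω : Set (EuclN N)) : Prop :=
  (∃ R : ℝ, 0 < R ∧ Ω = Metric.ball (0 : EuclN N) R) ∨
  (∃ r R : ℝ, 0 < r ∧ r < R ∧ Ω = {x : EuclN N | r < ‖x‖ ∧ ‖x‖ < R})

/-- The half-domain `Ω(e) = {x ∈ Ω : x·e > 0}`. -/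
def halfDom {N : ℕ} (Ω : Set (EuclN N)) (e : EuclN N) : Set (EuclN N) :=
  {x ∈ Ω | 0 < ⟪x, e⟫}

/-- Reflection through the hyperplane `T(e) = {x : x·e = 0}`. -/
def reflPt {N : ℕ} (e x : EuclN N) : EuclN N := x - (2 * ⟪x, e⟫) • e

/-- `U` is foliated Schwarz symmetric on `Ω` with respect to the axis `p`. -/
def FoliatedSchwarzWith {N m : ℕ} (Ω : Set (EuclN N)) (U : Fin m → EuclN N → ℝ)
    (p : EuclN N) : Prop :=
  ‖p‖ = 1 ∧ ∀ i, ∀ x ∈ Ω, ∀ y ∈ Ω, ‖x‖ = ‖y‖ → ⟪y, p⟫ ≤ ⟪x, p⟫ → U i y ≤ U i x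

/-- `U` is foliated Schwarz symmetric on `Ω`. -/
def FoliatedSchwarz {N m : ℕ} (Ω : Set (EuclN N)) (U : Fin m → EuclN N → ℝ) : Prop :=
  ∃ p : EuclN N, FoliatedSchwarzWith Ω U p

/-- `U` is radial on `Ω`. -/
def IsRadial {N m : ℕ} (Ω : Set (EuclN N)) (U : Fin m → EuclN N → ℝ) : Prop :=
  ∀ i, ∀ x ∈ Ω, ∀ y ∈ Ω, ‖x‖ = ‖y‖ → U i x = U i y

/-- `U` is a classical solution of `-Δu_i = f_i(|x|, U)` in `Ω`, `u_i = 0` on `∂Ω`. -/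
def IsSolution {N m : ℕ} (Ω : Set (EuclN N)) (f : Fin m → ℝ → (Fin m → ℝ) → ℝ)
    (U : Fin m → EuclN N → ℝ) : Prop :=
  (∀ i, ∀ x ∈ Ω, -lap (U i) x = f i ‖x‖ (fun k => U k x)) ∧
  (∀ i, ∀ x ∈ frontier Ω, U i x = 0)

/-- The bilinear form of the linear system `-ΔU + C(x) U`. -/
def BformL {N m : ℕ} (Ω' : Set (EuclN N)) (C : Fin m → Fin m → EuclN N → ℝ)
    (V Φ : Fin m → EuclN N → ℝ) : ℝ :=
  ∫ x in Ω', ((∑ i, ⟪gradient (V i) x, gradient (Φ i) x⟫) +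
    ∑ i, ∑ j, C i j x * V i x * Φ j x)

/-- `-ΔU + D U ≥ 0` weakly in `Ω'`. -/
def WeakSuperSol {N m : ℕ} (Ω' : Set (EuclN N)) (D : Fin m → Fin m → EuclN N → ℝ)
    (U : Fin m → EuclN N → ℝ) : Prop :=
  ∀ Ψ : Fin m → EuclN N → ℝ, IsTestFun Ω' Ψ → (∀ i x, 0 ≤ Ψ i x) →
    0 ≤ BformL Ω' D U Ψ

/-- `-ΔU + D U ≤ 0` weakly in `Ω'`. -/
def WeakSubSol {N m : ℕ} (Ω' : Set (EuclN N)) (D : Fin m → Fin m → EuclN N → ℝ)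
    (U : Fin m → EuclN N → ℝ) : Prop :=
  ∀ Ψ : Fin m → EuclN N → ℝ, IsTestFun Ω' Ψ → (∀ i x, 0 ≤ Ψ i x) →
    BformL Ω' D U Ψ ≤ 0

/-- The linear system with matrix `D` is cooperative in `Ω`: `d_ij ≤ 0` a.e. for `i ≠ j`. -/
def LinCoop {N m : ℕ} (Ω : Set (EuclN N)) (D : Fin m → Fin m → EuclN N → ℝ) : Prop :=
  ∀ i j, i ≠ j → ∀ᵐ x ∂(volume : Measure (EuclN N)), x ∈ Ω → D i j x ≤ 0

/-- The linear system with matrix `D` is fully coupled in `Ω`. -/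
def LinFullyCoupled {N m : ℕ} (Ω : Set (EuclN N)) (D : Fin m → Fin m → EuclN N → ℝ) : Prop :=
  LinCoop Ω D ∧
  ∀ I J : Finset (Fin m), I.Nonempty → J.Nonempty → Disjoint I J → I ∪ J = Finset.univ →
    ∃ i₀ ∈ I, ∃ j₀ ∈ J, 0 < volume {x ∈ Ω | D i₀ j₀ x < 0}

/-- First symmetric eigenvalue on `Ω'`: the infimum of the Rayleigh quotient of the
symmetric matrix `C` over nontrivial test functions. -/
def lamOneSym {N m : ℕ} (Ω' : Set (EuclN N)) (C : Fin m → Fin m → EuclN N → ℝ) : ℝ :=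
  sInf {r : ℝ | ∃ Ψ : Fin m → EuclN N → ℝ, IsTestFun Ω' Ψ ∧ (∃ i x, Ψ i x ≠ 0) ∧
    r = BformL Ω' C Ψ Ψ / ∫ x in Ω', ∑ i, (Ψ i x) ^ 2}

end

section
open MeasureTheory Real Set
open scoped RealInnerProductSpace ENNReal
open scoped Topology
open Filter

/-- partial derivative -/
noncomputable def pD {N : ℕ} (k : Fin N) (u : EuclN N → ℝ) (x : EuclN N) : ℝ :=
  fderiv ℝ u x (EuclideanSpace.single k 1)

lemma cont_mul_supp {N : ℕ} {Ω : Set (EuclN N)} (hΩ : IsOpen Ω) {a g : EuclN N → ℝ}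
    (ha : ContinuousOn a Ω) (hg : Continuous g) (hgΩ : tsupport g ⊆ Ω) :
    Continuous (fun x => a x * g x) := by
  rw [continuous_iff_continuousAt]
  intro x
  by_cases hx : x ∈ tsupport g
  · exact (ha.continuousAt (hΩ.mem_nhds (hgΩ hx))).mul hg.continuousAt
  · have : (fun x => a x * g x) =ᶠ[𝓝 x] fun _ => 0 := by
      have := notMem_tsupport_iff_eventuallyEq.1 hx
      filter_upwards [this] with y hy
      simp [hy]
    exact (continuousAt_const.congr this.symm)

lemma intg_mul_supp {N : ℕ} {Ω : Set (EuclN N)} (hΩ : IsOpen Ω) {a g : EuclN N → ℝ}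
    (ha : ContinuousOn a Ω) (hg : Continuous g) (hgc : HasCompactSupport g)
    (hgΩ : tsupport g ⊆ Ω) :
    Integrable (fun x => a x * g x) :=
  (cont_mul_supp hΩ ha hg hgΩ).integrable_of_hasCompactSupport hgc.mul_left

lemma pD_cont {N : ℕ} {g : EuclN N → ℝ} (hg : ContDiff ℝ 1 g) (k : Fin N) :
    Continuous (pD k g) := by
  have := hg.continuous_fderiv (by norm_num)
  unfold pD
  fun_prop

lemma pD_contOn {N : ℕ} {Ω : Set (EuclN N)} (hΩ : IsOpen Ω) {g : EuclN N → ℝ}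
    (hg : ContDiffOn ℝ 1 g Ω) (k : Fin N) :
    ContinuousOn (pD k g) Ω := by
  have := hg.continuousOn_fderiv_of_isOpen hΩ (by norm_num)
  unfold pD
  exact this.clm_apply continuousOn_const

lemma pD_supp {N : ℕ} {g : EuclN N → ℝ} (k : Fin N) : tsupport (pD k g) ⊆ tsupport g := by
  refine closure_minimal ?_ (isClosed_tsupport g)
  intro x hx
  by_contra h
  apply hx
  have : fderiv ℝ g x = 0 := by
    by_contra h2
    exact h (support_fderiv_subset ℝ (by simpa [Function.mem_support] using h2))
  simp [pD, this]

lemma pD_csupp {N : ℕ} {g : EuclN N → ℝ} (hg : HasCompactSupport g) (k : Fin N) :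
    HasCompactSupport (pD k g) := hg.of_isClosed_subset (isClosed_tsupport _) (pD_supp k)

lemma ibp {N : ℕ} {Ω : Set (EuclN N)} (hΩ : IsOpen Ω) {a g : EuclN N → ℝ}
    (ha : ContDiffOn ℝ 1 a Ω) (hg : ContDiff ℝ 1 g) (hgc : HasCompactSupport g)
    (hgΩ : tsupport g ⊆ Ω) (k : Fin N) :
    ∫ x, a x * pD k g x = - ∫ x, pD k a x * g x := by
  unfold pD
  apply integral_mul_fderiv_eq_neg_fderiv_mul_of_integrable
  · exact intg_mul_supp hΩ (pD_contOn hΩ ha k) hg.continuous hgc hgΩ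
  · exact intg_mul_supp hΩ ha.continuousOn (pD_cont hg k) (pD_csupp hgc k) ((pD_supp k).trans hgΩ)
  · exact intg_mul_supp hΩ ha.continuousOn hg.continuous hgc hgΩ
  · intro x hx
    exact (ha.contDiffAt (hΩ.mem_nhds (hgΩ hx))).differentiableAt (by norm_num)
  · intro x _
    exact hg.differentiable (by norm_num) x

lemma gradient_apply' {N : ℕ} (u : EuclN N → ℝ) (x : EuclN N) (k : Fin N) :
    (gradient u x) k = pD k u x := by
  have : ⟪gradient u x, EuclideanSpace.single k (1:ℝ)⟫ = pD k u x := by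
    unfold pD gradient
    rw [InnerProductSpace.toDual_symm_apply]
  rw [← this, EuclideanSpace.inner_single_right]
  simp

lemma norm_gradient_sq {N : ℕ} (u : EuclN N → ℝ) (x : EuclN N) :
    ‖gradient u x‖ ^ 2 = ∑ k, pD k u x ^ 2 := by
  rw [EuclideanSpace.norm_sq_eq]
  simp [gradient_apply']

lemma lap_eq {N : ℕ} {Ω : Set (EuclN N)} (hΩ : IsOpen Ω) {u : EuclN N → ℝ}
    (hu : ContDiffOn ℝ 2 u Ω) {x : EuclN N} (hx : x ∈ Ω) :
    lap u x = ∑ k, pD k (pD k u) x := by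
  unfold lap
  refine Finset.sum_congr rfl fun k _ => ?_
  rw [iteratedFDeriv_two_apply]
  have h1 : DifferentiableAt ℝ (fderiv ℝ u) x := by
    have : ContDiffAt ℝ 1 (fderiv ℝ u) x :=
      (hu.contDiffAt (hΩ.mem_nhds hx)).fderiv_right (by norm_num)
    exact this.differentiableAt (by norm_num)
  have h2 : fderiv ℝ (pD k u) x = _ :=
    (h1.hasFDerivAt.clm_apply (hasFDerivAt_const (EuclideanSpace.single k (1:ℝ)) x)).fderiv
  conv_rhs => rw [pD, h2]
  simp

lemma pD_contDiffOn {N : ℕ} {Ω : Set (EuclN N)} (hΩ : IsOpen Ω) {u : EuclN N → ℝ}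
    (hu : ContDiffOn ℝ 2 u Ω) (k : Fin N) : ContDiffOn ℝ 1 (pD k u) Ω := by
  have h : ContDiffOn ℝ 1 (fderiv ℝ u) Ω := hu.fderiv_of_isOpen hΩ (by norm_num)
  exact h.clm_apply contDiffOn_const

/-- weak form -/
lemma weak_form {N : ℕ} {Ω : Set (EuclN N)} (hΩ : IsOpen Ω) {u g F : EuclN N → ℝ}
    (hu : ContDiffOn ℝ 2 u Ω) (hF : ∀ x ∈ Ω, - lap u x = F x)
    (hg : ContDiff ℝ 1 g) (hgc : HasCompactSupport g)
    (hgΩ : tsupport g ⊆ Ω) :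
    ∫ x, fderiv ℝ u x (gradient g x) = ∫ x, F x * g x := by
  have e1 : ∀ x, fderiv ℝ u x (gradient g x) = ∑ k, pD k u x * pD k g x := by
    intro x
    conv_lhs => rw [show gradient g x = ∑ k, (gradient g x) k • EuclideanSpace.single k (1:ℝ) from by
      ext j; simp [Finset.sum_apply, Pi.single_apply]]
    rw [map_sum]
    refine Finset.sum_congr rfl fun k _ => ?_
    rw [map_smul, gradient_apply', smul_eq_mul, mul_comm]; rfl
  simp_rw [e1]
  have hk := pD_contDiffOn hΩ hu
  rw [integral_finsetSum]
  · simp_rw [ibp hΩ (hk _) hg hgc hgΩ]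
    rw [Finset.sum_neg_distrib, ← integral_finsetSum, ← integral_neg]
    · congr 1; ext x
      by_cases hx : x ∈ Ω
      · rw [← hF x hx, lap_eq hΩ hu hx, ← Finset.sum_mul]; ring
      · have : g x = 0 := by
          by_contra h; exact hx (hgΩ (subset_tsupport _ h))
        simp [this]
    · intro k _
      exact intg_mul_supp hΩ (pD_contOn hΩ (hk k) k) hg.continuous hgc hgΩ
  · intro k _
    exact intg_mul_supp hΩ (hk k).continuousOn (pD_cont hg k) (pD_csupp hgc k) ((pD_supp k).trans hgΩ)

lemma deriv_under {N : ℕ} {K : Set (EuclN N)} (hK : IsCompact K) (G G' : ℝ → EuclN N → ℝ)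
    (hG : ∀ t, ContinuousOn (G t) K)
    (hG' : ContinuousOn (fun p : ℝ × EuclN N => G' p.1 p.2) (univ ×ˢ K))
    (hd : ∀ x ∈ K, ∀ t, HasDerivAt (fun t => G t x) (G' t x) t) (t₀ : ℝ) :
    HasDerivAt (fun t => ∫ x in K, G t x) (∫ x in K, G' t₀ x) t₀ := by
  have hc : IsCompact (Icc (t₀ - 1) (t₀ + 1) ×ˢ K) := isCompact_Icc.prod hK
  obtain ⟨C, hC⟩ := hc.exists_bound_of_continuousOn (hG'.mono (prod_mono (subset_univ _) le_rfl))
  refine (hasDerivAt_integral_of_dominated_loc_of_deriv_le (s := Icc (t₀ - 1) (t₀ + 1))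
    (bound := fun _ => C)
    (Icc_mem_nhds (by linarith) (by linarith)) ?_ ?_ ?_ ?_ ?_ ?_).2
  · exact Eventually.of_forall fun t => (hG t).aestronglyMeasurable hK.measurableSet
  · exact (hG t₀).integrableOn_compact hK
  · refine ContinuousOn.aestronglyMeasurable ?_ hK.measurableSet
    exact hG'.comp (f := fun x => (t₀, x)) (by fun_prop) (fun x hx => ⟨mem_univ _, hx⟩)
  · refine (ae_restrict_iff' hK.measurableSet).2 (Eventually.of_forall fun x hx t ht => ?_)
    exact hC (t, x) ⟨ht, hx⟩
  · have : IsFiniteMeasure (volume.restrict K) := ⟨by simpa using hK.measure_lt_top⟩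
    exact integrable_const C
  · refine (ae_restrict_iff' hK.measurableSet).2 (Eventually.of_forall fun x hx t _ => hd x hx t)

end

section
open MeasureTheory Real Set
open scoped RealInnerProductSpace ENNReal
open scoped Topology
open Filter

lemma hasDerivAt_maxpow (n : ℕ) (t : ℝ) :
    HasDerivAt (fun t : ℝ => (max 0 t) ^ (n + 2)) ((n + 2 : ℝ) * (max 0 t) ^ (n + 1)) t := by
  rcases lt_trichotomy t 0 with h | h | h
  · have e : (fun t : ℝ => (max 0 t) ^ (n + 2)) =ᶠ[𝓝 t] fun _ => 0 := by
      filter_upwards [Iio_mem_nhds h] with s hs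
      rw [max_eq_left (le_of_lt hs)]; simp
    have : HasDerivAt (fun _ : ℝ => (0:ℝ)) 0 t := hasDerivAt_const _ _
    rw [max_eq_left h.le]
    simpa using this.congr_of_eventuallyEq e
  · subst h
    rw [hasDerivAt_iff_isLittleO]
    simp only [max_self, sub_zero]
    have : (fun x : ℝ => x ^ (n + 2)) =o[𝓝 0] fun x => x := by
      have := Asymptotics.isLittleO_pow_pow (𝕜 := ℝ) (m := 1) (n := n + 2) (by omega)
      simpa using this
    refine Asymptotics.IsBigO.trans_isLittleO ?_ this
    refine Asymptotics.IsBigO.of_bound 1 (Eventually.of_forall fun x => ?_)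
    simp only [ne_eq, Nat.add_eq_zero_iff, OfNat.ofNat_ne_zero, and_false, not_false_eq_true, zero_pow, sub_zero, mul_zero, norm_pow, one_mul, smul_eq_mul, one_ne_zero]
    gcongr
    simp only [Real.norm_eq_abs]
    rcases le_total 0 x with h | h
    · simp [h]
    · simp [h]
  · have e : (fun t : ℝ => (max 0 t) ^ (n + 2)) =ᶠ[𝓝 t] fun t => t ^ (n + 2) := by
      filter_upwards [Ioi_mem_nhds h] with s hs
      rw [max_eq_right (le_of_lt hs)]
    rw [max_eq_right h.le]
    have := (hasDerivAt_pow (n + 2) t).congr_of_eventuallyEq e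
    simpa using this

lemma contDiff_maxpow (n : ℕ) : ContDiff ℝ 1 (fun t : ℝ => (max 0 t) ^ (n + 2)) := by
  rw [contDiff_one_iff_deriv]
  refine ⟨fun t => (hasDerivAt_maxpow n t).differentiableAt, ?_⟩
  have : deriv (fun t : ℝ => (max 0 t) ^ (n + 2)) = fun t => (n + 2 : ℝ) * (max 0 t) ^ (n + 1) := by
    ext t; exact (hasDerivAt_maxpow n t).deriv
  rw [this]; fun_prop

lemma pD_maxpow {N : ℕ} (n : ℕ) (s : ℝ) (y x : EuclN N) (k : Fin N) :
    pD k (fun x => (max 0 (s ^ 2 - ‖x - y‖ ^ 2)) ^ (n + 2)) x =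
     (n + 2 : ℝ) * (max 0 (s ^ 2 - ‖x - y‖ ^ 2)) ^ (n + 1) * (-2 * (x k - y k)) := by
  have h1 : HasFDerivAt (fun x : EuclN N => s ^ 2 - ‖x - y‖ ^ 2) _ x :=
    (((hasFDerivAt_id x).sub_const y).norm_sq).const_sub (s ^ 2)
  have h2 := (hasDerivAt_maxpow n (s ^ 2 - ‖x - y‖ ^ 2)).comp_hasFDerivAt x h1
  have h3 := h2.fderiv
  unfold pD
  have e : (fun x : EuclN N => (max 0 (s ^ 2 - ‖x - y‖ ^ 2)) ^ (n + 2)) =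
    ((fun t : ℝ => (max 0 t) ^ (n + 2)) ∘ fun x : EuclN N => s ^ 2 - ‖x - y‖ ^ 2) := rfl
  rw [e, h3]
  simp [EuclideanSpace.inner_single_right]

lemma contDiff_phi {N : ℕ} (n : ℕ) (s : ℝ) (y : EuclN N) :
    ContDiff ℝ 1 (fun x : EuclN N => (max 0 (s ^ 2 - ‖x - y‖ ^ 2)) ^ (n + 2)) := by
  have : ContDiff ℝ 1 (fun x : EuclN N => s ^ 2 - ‖x - y‖ ^ 2) :=
    contDiff_const.sub ((contDiff_id.sub contDiff_const).norm_sq ℝ)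
  exact (contDiff_maxpow n).comp this

lemma pD_phi_fun {N : ℕ} (s : ℝ) (y : EuclN N) (k : Fin N) :
    pD k (fun x => (max 0 (s ^ 2 - ‖x - y‖ ^ 2)) ^ 3) = fun x =>
     (max 0 (s ^ 2 - ‖x - y‖ ^ 2)) ^ 2 * (-6 * (x k - y k)) := by
  ext x
  have := pD_maxpow 1 s y x k
  norm_num at this
  rw [this]; ring

lemma coord_contDiff {N : ℕ} (y : EuclN N) (k : Fin N) :
    ContDiff ℝ 1 (fun x : EuclN N => -6 * (x k - y k)) := by
  have : ContDiff ℝ 1 (fun x : EuclN N => x k) := (EuclideanSpace.proj (𝕜 := ℝ) k).contDiff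
  fun_prop

lemma pD_phi_contDiff {N : ℕ} (s : ℝ) (y : EuclN N) (k : Fin N) :
    ContDiff ℝ 1 (pD k (fun x => (max 0 (s ^ 2 - ‖x - y‖ ^ 2)) ^ 3)) := by
  rw [pD_phi_fun]
  exact (contDiff_phi 0 s y).mul (coord_contDiff y k)

lemma pD_pD_phi {N : ℕ} (s : ℝ) (y x : EuclN N) (k : Fin N) :
    pD k (pD k (fun x => (max 0 (s ^ 2 - ‖x - y‖ ^ 2)) ^ 3)) x =
     -6 * (max 0 (s ^ 2 - ‖x - y‖ ^ 2)) ^ 2 +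
       24 * (x k - y k) ^ 2 * max 0 (s ^ 2 - ‖x - y‖ ^ 2) := by
  rw [pD_phi_fun]
  have h1 : DifferentiableAt ℝ (fun x : EuclN N => (max 0 (s ^ 2 - ‖x - y‖ ^ 2)) ^ 2) x :=
    (contDiff_phi 0 s y).differentiable (by norm_num) x
  have h2 : DifferentiableAt ℝ (fun x : EuclN N => -6 * (x k - y k)) x :=
    (coord_contDiff y k).differentiable (by norm_num) x
  have h3 := pD_maxpow 0 s y x k
  have h4 : pD k (fun x : EuclN N => -6 * (x k - y k)) x = -6 := by
    have hx : HasFDerivAt (fun x : EuclN N => x k) (EuclideanSpace.proj (𝕜 := ℝ) k) x :=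
      (EuclideanSpace.proj (𝕜 := ℝ) k).hasFDerivAt
    have := ((hx.sub_const (y k)).const_mul (-6)).fderiv
    unfold pD
    rw [this]
    simp
  unfold pD at h3 h4 ⊢
  rw [show (fun x : EuclN N => (max 0 (s ^ 2 - ‖x - y‖ ^ 2)) ^ 2 * (-6 * (x k - y k))) =
    (fun x : EuclN N => (max 0 (s ^ 2 - ‖x - y‖ ^ 2)) ^ 2) * (fun x : EuclN N => -6 * (x k - y k)) from rfl]
  rw [fderiv_mul h1 h2]
  simp only [add_apply, smul_apply, smul_eq_mul]
  rw [h4]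
  norm_num at h3
  rw [h3]; ring

lemma lap_phi {N : ℕ} (s : ℝ) (y x : EuclN N) :
    ∑ k, pD k (pD k (fun x => (max 0 (s ^ 2 - ‖x - y‖ ^ 2)) ^ 3)) x =
     24 * s ^ 2 * max 0 (s ^ 2 - ‖x - y‖ ^ 2)
      - (6 * N + 24) * (max 0 (s ^ 2 - ‖x - y‖ ^ 2)) ^ 2 := by
  simp_rw [pD_pD_phi]
  rw [Finset.sum_add_distrib, ← Finset.sum_mul, ← Finset.sum_mul, ← Finset.mul_sum]
  have : ∑ k, (x k - y k) ^ 2 = ‖x - y‖ ^ 2 := by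
    rw [EuclideanSpace.norm_sq_eq]; simp
  rw [this]
  simp only [Finset.sum_const, Finset.card_univ, Fintype.card_fin, nsmul_eq_mul]
  rcases le_total 0 (s ^ 2 - ‖x - y‖ ^ 2) with h | h
  · rw [max_eq_right h]; ring
  · rw [max_eq_left h]; ring

lemma phi_zero {N : ℕ} {s : ℝ} (hs : 0 ≤ s) (y x : EuclN N) (hx : x ∉ Metric.closedBall y s) :
    max 0 (s ^ 2 - ‖x - y‖ ^ 2) = 0 := by
  apply max_eq_left
  rw [Metric.mem_closedBall, dist_eq_norm] at hx
  push Not at hx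
  nlinarith

/-- truncated paraboloid -/
noncomputable def qf {N : ℕ} (y : EuclN N) (s : ℝ) (x : EuclN N) : ℝ :=
  max 0 (s ^ 2 - ‖x - y‖ ^ 2)

lemma qf_supp {N : ℕ} (n : ℕ) (hn : n ≠ 0) {s : ℝ} (hs : 0 ≤ s) (y : EuclN N) :
    tsupport (fun x : EuclN N => qf y s x ^ n) ⊆ Metric.closedBall y s := by
  refine closure_minimal ?_ Metric.isClosed_closedBall
  intro x hx
  by_contra h
  apply hx
  have : qf y s x = 0 := phi_zero hs y x h
  simp [this, hn]

lemma qf_csupp {N : ℕ} (n : ℕ) (hn : n ≠ 0) {s : ℝ} (hs : 0 ≤ s) (y : EuclN N) :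
    HasCompactSupport (fun x : EuclN N => qf y s x ^ n) :=
  (isCompact_closedBall y s).of_isClosed_subset (isClosed_tsupport _) (qf_supp n hn hs y)

lemma qf_contDiff3 {N : ℕ} (s : ℝ) (y : EuclN N) :
    ContDiff ℝ 1 (fun x : EuclN N => qf y s x ^ 3) := contDiff_phi 1 s y

lemma qf_pD_contDiff {N : ℕ} (s : ℝ) (y : EuclN N) (k : Fin N) :
    ContDiff ℝ 1 (pD k (fun x : EuclN N => qf y s x ^ 3)) := pD_phi_contDiff s y k

lemma qf_lap {N : ℕ} (s : ℝ) (y x : EuclN N) :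
    ∑ k, pD k (pD k (fun x => qf y s x ^ 3)) x =
     24 * s ^ 2 * qf y s x - (6 * N + 24) * qf y s x ^ 2 := lap_phi s y x

lemma qf_deriv {N : ℕ} (t : ℝ) (y x : EuclN N) :
    HasDerivAt (fun t => qf y t x ^ 2) (2 * qf y t x * (2 * t)) t := by
  have h1 : HasDerivAt (fun t : ℝ => t ^ 2 - ‖x - y‖ ^ 2) (2 * t) t := by
    simpa using (hasDerivAt_pow 2 t).sub_const (‖x - y‖ ^ 2)
  have h2 := (hasDerivAt_maxpow 0 (t ^ 2 - ‖x - y‖ ^ 2)).comp t h1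
  simpa [qf, Function.comp_def] using h2

lemma qf_cont {N : ℕ} (y : EuclN N) : Continuous (fun p : ℝ × EuclN N => qf y p.1 p.2) := by
  unfold qf; fun_prop

lemma qf_zero {N : ℕ} {s : ℝ} (hs : 0 ≤ s) (y x : EuclN N) (hx : x ∉ Metric.closedBall y s) :
    qf y s x = 0 := phi_zero hs y x hx

lemma qf_nonneg {N : ℕ} (s : ℝ) (y x : EuclN N) : 0 ≤ qf y s x := le_max_left _ _

lemma qf_le {N : ℕ} (s : ℝ) (y x : EuclN N) : qf y s x ≤ s ^ 2 := by
  unfold qf; apply max_le (by positivity); nlinarith [norm_nonneg (x - y)]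

lemma qf_pos {N : ℕ} (s : ℝ) (y x : EuclN N) (h : ‖x - y‖ < s) : 0 < qf y s x :=
  lt_max_of_lt_right (by nlinarith [norm_nonneg (x - y)])

end

section
open MeasureTheory Real Set
open scoped RealInnerProductSpace ENNReal
open scoped Topology
open Filter

lemma mono_abs {N : ℕ} {K S V : ℝ} (hK : 0 ≤ K) (A A' : ℝ → ℝ) (hd : ∀ s, HasDerivAt A (A' s) s)
    (hA : ∀ s, 0 ≤ A s)
    (key : ∀ s, 0 < s → s < S → s * A' s ≤ (N + 4 + K * s ^ 2 / 6) * A s) (hv : 0 ≤ V)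
    (hsmall : ∀ δ > 0, ∃ r > 0, ∀ t, 0 < t → t < r → A t ≤ δ * t ^ 4 * (t ^ N * V)) :
    ∀ s, 0 < s → s < S → A s = 0 := by
  set M : ℝ → ℝ := fun s => A s * (exp (-(K * s ^ 2 / 12)) * (s ^ (N + 4))⁻¹) with hM
  have hMd : ∀ s, 0 < s → HasDerivAt M
      (A' s *
        (exp (-(K * s ^ 2 / 12)) * (s ^ (N + 4))⁻¹) +
        A s * (exp (-(K * s ^ 2 / 12)) * (-(K * s / 6)) * (s ^ (N + 4))⁻¹ +
          exp (-(K * s ^ 2 / 12)) * (-((N + 4 : ℝ) * s ^ (N + 3)) / (s ^ (N + 4)) ^ 2))) s := by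
    intro s hs
    refine (hd s).mul (HasDerivAt.mul ?_ ?_)
    · have h1 : HasDerivAt (fun s : ℝ => -(K * s ^ 2 / 12)) (-(K * s / 6)) s := by
        have := (((hasDerivAt_pow 2 s).const_mul K).div_const 12).neg
        refine this.congr_deriv ?_
        simp; ring
      exact h1.exp
    · have h1 := (hasDerivAt_pow (N + 4) s).fun_inv (by positivity)
      simpa using h1
  have hMa : AntitoneOn M (Ioo 0 S) := by
    refine antitoneOn_of_deriv_nonpos (convex_Ioo 0 S)
      (fun s hs => (hMd s hs.1).continuousAt.continuousWithinAt)
      (fun s hs => ?_) (fun s hs => ?_)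
    · rw [interior_Ioo] at hs
      exact (hMd s hs.1).differentiableAt.differentiableWithinAt
    · rw [interior_Ioo] at hs
      rw [(hMd s hs.1).deriv]
      have hs0 := hs.1
      have k := key s hs.1 hs.2
      have : A' s * (exp (-(K * s ^ 2 / 12)) * (s ^ (N + 4))⁻¹) +
        A s * (exp (-(K * s ^ 2 / 12)) * (-(K * s / 6)) * (s ^ (N + 4))⁻¹ +
          exp (-(K * s ^ 2 / 12)) * (-((N + 4 : ℝ) * s ^ (N + 3)) / (s ^ (N + 4)) ^ 2)) =
        (exp (-(K * s ^ 2 / 12)) * (s ^ (N + 5))⁻¹) * (s * A' s - (N + 4 + K * s ^ 2 / 6) * A s) := by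
        generalize exp (-(K * s ^ 2 / 12)) = E
        field_simp
        ring
      rw [this]
      exact mul_nonpos_of_nonneg_of_nonpos (by positivity) (by linarith)
  intro s hs hsS
  have hM0 : M s ≤ 0 := by
    have hb : ∀ δ > 0, M s ≤ δ * V := by
      intro δ hδ
      obtain ⟨r, hr, hr2⟩ := hsmall δ hδ
      set t := min (r / 2) s with ht
      have ht0 : 0 < t := by rw [ht]; positivity
      have hts : t ≤ s := min_le_right _ _
      have htr : t < r := lt_of_le_of_lt (min_le_left _ _) (by linarith)
      have h1 : M s ≤ M t := hMa ⟨ht0, lt_of_le_of_lt hts hsS⟩ ⟨hs, hsS⟩ hts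
      refine h1.trans ?_
      have hAt := hr2 t ht0 htr
      have he : exp (-(K * t ^ 2 / 12)) ≤ 1 := by
        rw [Real.exp_le_one_iff]; have : 0 ≤ K * t ^ 2 / 12 := by positivity
        linarith
      calc M t = A t * (exp (-(K * t ^ 2 / 12)) * (t ^ (N + 4))⁻¹) := rfl
        _ ≤ (δ * t ^ 4 * (t ^ N * V)) * (1 * (t ^ (N + 4))⁻¹) := by gcongr
        _ = δ * V := by field_simp; ring
    by_contra hneg
    push Not at hneg
    have := hb (M s / (2 * (V + 1))) (by positivity)
    have h2 : M s / (2 * (V + 1)) * V ≤ M s / 2 := by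
      rw [div_mul_eq_mul_div, div_le_div_iff₀ (by positivity) (by positivity)]
      nlinarith
    linarith
  have h3 : 0 < exp (-(K * s ^ 2 / 12)) * (s ^ (N + 4))⁻¹ := by positivity
  exact le_antisymm (nonpos_of_mul_nonpos_left hM0 h3) (hA s)

lemma meanvalue {N : ℕ} {Ω : Set (EuclN N)} (w : EuclN N → ℝ) (hw : Continuous w)
    (hw0 : ∀ x, 0 ≤ w x) (K : ℝ) (hK : 0 ≤ K)
    (H : ∀ φ : EuclN N → ℝ, ContDiff ℝ 1 φ → HasCompactSupport φ → tsupport φ ⊆ Ω →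
      (∀ x, 0 ≤ φ x) → (∀ k, ContDiff ℝ 1 (pD k φ)) →
      ∫ x, w x * ∑ k, pD k (pD k φ) x ≤ K * ∫ x, w x * φ x)
    (y : EuclN N) (hy : w y = 0) (S : ℝ) (hS : Metric.closedBall y S ⊆ Ω) :
    ∀ x ∈ Metric.ball y S, w x = 0 := by
  have qc : ∀ s, Continuous (qf y s) := fun s => (qf_cont y).comp (by fun_prop : Continuous fun x => (s, x))
  have q0 : ∀ s x, 0 ≤ qf y s x := fun s x => qf_nonneg s y x
  have qs : ∀ s x, qf y s x ≤ s ^ 2 := fun s x => qf_le s y x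
  have hint : ∀ s, 0 ≤ s → ∀ n, n ≠ 0 → Integrable (fun x => w x * qf y s x ^ n) := by
    intro s hs n hn
    exact (hw.mul ((qc s).pow _)).integrable_of_hasCompactSupport ((qf_csupp n hn hs y).mul_left)
  obtain ⟨A, hA⟩ : ∃ A : ℝ → ℝ, ∀ s, A s = ∫ x in Metric.closedBall y S, w x * qf y s x ^ 2 :=
    ⟨_, fun _ => rfl⟩
  obtain ⟨A', hA'⟩ : ∃ A' : ℝ → ℝ, ∀ s, A' s =
      ∫ x in Metric.closedBall y S, w x * (2 * qf y s x * (2 * s)) :=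
    ⟨_, fun _ => rfl⟩
  have whole : ∀ s, 0 ≤ s → s ≤ S → ∀ n, n ≠ 0 → ∫ x in Metric.closedBall y S, w x * qf y s x ^ n
      = ∫ x, w x * qf y s x ^ n := by
    intro s hs hsS n hn
    refine setIntegral_eq_integral_of_forall_compl_eq_zero fun x hx => ?_
    have : qf y s x = 0 := qf_zero hs y x (fun h => hx (Metric.closedBall_subset_closedBall hsS h))
    simp [this, hn]
  have hder : ∀ s, HasDerivAt A (A' s) s := by
    intro s
    rw [hA' s, show A = _ from funext hA]
    refine deriv_under (isCompact_closedBall y S) (fun s x => w x * qf y s x ^ 2)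
      (fun s x => w x * (2 * qf y s x * (2 * s))) ?_ ?_ ?_ s
    · intro t
      exact (hw.mul ((qc t).pow _)).continuousOn
    · have := qf_cont y
      apply Continuous.continuousOn
      fun_prop
    · intro x _ t
      exact (qf_deriv t y x).const_mul _
  have hAn : ∀ s, 0 ≤ A s := fun s => by
    rw [hA]; exact integral_nonneg fun x => mul_nonneg (hw0 x) (sq_nonneg _)
  have key : ∀ s, 0 < s → s < S → s * A' s ≤ (N + 4 + K * s ^ 2 / 6) * A s := by
    intro s hs hsS
    have h := H (fun x => qf y s x ^ 3) (qf_contDiff3 s y) (qf_csupp 3 (by norm_num) hs.le y)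
      ((qf_supp 3 (by norm_num) hs.le y).trans ((Metric.closedBall_subset_closedBall hsS.le).trans hS))
      (fun x => pow_nonneg (q0 s x) 3) (qf_pD_contDiff s y)
    have e1 : ∀ x, w x * ∑ k, pD k (pD k (fun x => qf y s x ^ 3)) x =
        24 * s ^ 2 * (w x * qf y s x ^ 1) - (6 * N + 24) * (w x * qf y s x ^ 2) := by
      intro x
      rw [qf_lap s y x]
      ring
    simp_rw [e1] at h
    rw [integral_sub ((hint s hs.le 1 one_ne_zero).const_mul _) ((hint s hs.le 2 two_ne_zero).const_mul _),
      integral_const_mul, integral_const_mul] at h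
    have h3 : ∫ x, w x * qf y s x ^ 3 ≤ s ^ 2 * ∫ x, w x * qf y s x ^ 2 := by
      rw [← integral_const_mul]
      refine integral_mono (hint s hs.le 3 (by norm_num)) ((hint s hs.le 2 two_ne_zero).const_mul _) fun x => ?_
      have := mul_le_mul_of_nonneg_left (qs s x) (mul_nonneg (hw0 x) (sq_nonneg (qf y s x)))
      calc w x * qf y s x ^ 3 = w x * qf y s x ^ 2 * qf y s x := by ring
        _ ≤ w x * qf y s x ^ 2 * s ^ 2 := this
        _ = s ^ 2 * (w x * qf y s x ^ 2) := by ring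
    have e2 : A' s = 4 * s * ∫ x, w x * qf y s x ^ 1 := by
      rw [hA', ← whole s hs.le hsS.le 1 one_ne_zero, ← integral_const_mul]
      congr 1; ext x; ring
    have e3 : A s = ∫ x, w x * qf y s x ^ 2 := by
      rw [hA, whole s hs.le hsS.le 2 two_ne_zero]
    rw [e2, e3]
    have h4 := mul_le_mul_of_nonneg_left h3 hK
    generalize ∫ x, w x * qf y s x ^ 1 = I1 at *
    generalize ∫ x, w x * qf y s x ^ 2 = I2 at *
    generalize ∫ x, w x * qf y s x ^ 3 = I3 at *
    nlinarith
  have hA0 := mono_abs (N := N) (V := (volume : Measure (EuclN N)).real (Metric.closedBall 0 1))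
    hK A A' hder hAn key measureReal_nonneg ?_
  · intro x hx
    rw [Metric.mem_ball, dist_eq_norm] at hx
    obtain ⟨s, hs1, hs2⟩ := exists_between hx
    have hs0 : 0 < s := lt_of_le_of_lt (norm_nonneg _) hs1
    by_contra hne
    have e3 : A s = ∫ x, w x * qf y s x ^ 2 := by
      rw [hA, whole s hs0.le hs2.le 2 two_ne_zero]
    have hq1 : 0 < qf y s x := qf_pos s y x hs1
    have c1 : Continuous (fun x => w x * qf y s x ^ 2) := hw.mul ((qc s).pow 2)
    have c2 : HasCompactSupport (fun x => w x * qf y s x ^ 2) :=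
      HasCompactSupport.mul_left (f := w) (f' := fun x => qf y s x ^ 2) (qf_csupp 2 two_ne_zero hs0.le y)
    have c3 : 0 ≤ (fun x => w x * qf y s x ^ 2) :=
      fun x => mul_nonneg (hw0 x) (pow_nonneg (q0 s x) 2)
    have c4 : w x * qf y s x ^ 2 ≠ 0 := mul_ne_zero hne (pow_pos hq1 2).ne'
    have := Continuous.integral_pos_of_hasCompactSupport_nonneg_nonzero (μ := (volume : Measure (EuclN N)))
      c1 c2 c3 c4
    rw [← e3, hA0 s hs0 hs2] at this
    exact lt_irrefl _ this
  · intro δ hδ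
    have : ∀ᶠ x in 𝓝 y, w x < δ := hw.continuousAt.eventually_lt continuousAt_const (by simpa [hy])
    obtain ⟨r, hr, hr2⟩ := Metric.eventually_nhds_iff_ball.1 this
    refine ⟨r, hr, fun t ht0 htr => ?_⟩
    have e5 : (volume : Measure (EuclN N)).real (Metric.closedBall y t) = t ^ N *
      (volume : Measure (EuclN N)).real (Metric.closedBall 0 1) := by
      rw [Measure.addHaar_real_closedBall' _ _ ht0.le]; simp
    rw [← e5]
    have e3 : A t ≤ ∫ x, w x * qf y t x ^ 2 := by
      rw [hA]
      exact setIntegral_le_integral (hint t ht0.le 2 two_ne_zero)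
        (Eventually.of_forall fun x => mul_nonneg (hw0 x) (sq_nonneg _))
    have e4 : ∫ x, w x * qf y t x ^ 2 = ∫ x in Metric.closedBall y t, w x * qf y t x ^ 2 := by
      symm
      refine setIntegral_eq_integral_of_forall_compl_eq_zero fun x hx => ?_
      have : qf y t x = 0 := qf_zero ht0.le y x hx
      simp [this]
    refine e3.trans ?_
    rw [e4]
    have : ∫ x in Metric.closedBall y t, w x * qf y t x ^ 2 ≤ ∫ x in Metric.closedBall y t, δ * t ^ 4 := by
      refine setIntegral_mono_on ?_ ?_ measurableSet_closedBall ?_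
      · exact (hint t ht0.le 2 two_ne_zero).integrableOn
      · exact continuousOn_const.integrableOn_compact (isCompact_closedBall y t)
      · intro x hx
        have h1 : w x ≤ δ := (hr2 x (Metric.closedBall_subset_ball htr hx)).le
        have h2 : qf y t x ^ 2 ≤ t ^ 4 := by
          calc qf y t x ^ 2 ≤ (t ^ 2) ^ 2 := pow_le_pow_left₀ (q0 t x) (qs t x) 2
            _ = t ^ 4 := by ring
        exact mul_le_mul h1 h2 (sq_nonneg _) hδ.le
    refine this.trans (le_of_eq ?_)
    simp [mul_comm]

end

section
open MeasureTheory Real Set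
open scoped RealInnerProductSpace ENNReal
open scoped Topology
open Filter

lemma trunc_one {ε : ℝ} (hε : 0 < ε) (h : ℝ → ℝ) (hc : Continuous h) (h0 : ∀ t, 0 ≤ h t)
    (h1 : ∀ t, h t ≤ 1) (hz : ∀ t ≤ ε, h t = 0) (ho : ∀ t, 2 * ε ≤ t → h t = 1) :
    ∃ H : ℝ → ℝ, (∀ t, HasDerivAt H (h t) t) ∧ (∀ t ≤ ε, H t = 0) ∧
      (∀ t, 0 ≤ H t) ∧ (∀ t, H t ≤ max 0 t) ∧ (∀ t, max 0 t - 2 * ε ≤ H t) := by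
  have hi : ∀ a b, IntervalIntegrable h volume a b := fun a b => hc.intervalIntegrable a b
  have hle : ∀ t ≤ ε, ∫ s in (0:ℝ)..t, h s = 0 := by
    intro t ht
    have : ∫ s in (0:ℝ)..t, h s = ∫ s in (0:ℝ)..t, (0:ℝ) := by
      refine intervalIntegral.integral_congr fun s hs => ?_
      apply hz
      have := hs.2
      exact this.trans (max_le hε.le ht)
    simpa using this
  have hnn : ∀ t, 0 ≤ ∫ s in (0:ℝ)..t, h s := by
    intro t
    rcases le_total t ε with ht | ht
    · rw [hle t ht]
    · exact intervalIntegral.integral_nonneg (by linarith) fun s _ => h0 s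
  refine ⟨fun t => ∫ s in (0:ℝ)..t, h s, ?_, hle, hnn, ?_, ?_⟩
  · intro t
    exact intervalIntegral.integral_hasDerivAt_right (hi 0 t) (hc.stronglyMeasurableAtFilter _ _) hc.continuousAt
  · intro t
    rcases le_total t ε with ht | ht
    · simp only [hle t ht]; exact le_max_left _ _
    · have ht0 : 0 ≤ t := by linarith
      have : ∫ s in (0:ℝ)..t, h s ≤ ∫ s in (0:ℝ)..t, (1:ℝ) :=
        intervalIntegral.integral_mono_on ht0 (hi 0 t) (by simp) fun s _ => h1 s
      refine le_trans ?_ (le_max_right _ _)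
      simpa using this
  · intro t
    rcases le_total t (2 * ε) with ht | ht
    · refine le_trans ?_ (hnn t)
      rw [sub_nonpos]; exact max_le (by linarith) ht
    · simp only
      rw [max_eq_right (by linarith : (0:ℝ) ≤ t), ← intervalIntegral.integral_add_adjacent_intervals (hi 0 (2 * ε)) (hi (2 * ε) t)]
      have : ∫ s in (2 * ε)..t, h s = ∫ s in (2 * ε)..t, (1:ℝ) := by
        refine intervalIntegral.integral_congr fun s hs => ?_
        apply ho
        rw [uIcc_of_le ht] at hs
        exact hs.1
      rw [this]
      have := hnn (2 * ε)
      simp; linarith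

lemma trunc {ε : ℝ} (hε : 0 < ε) : ∃ κ g G : ℝ → ℝ, Continuous κ ∧
    ((∀ t, HasDerivAt g (κ t) t) ∧ (∀ t ≤ ε, g t = 0) ∧
      (∀ t, 0 ≤ g t) ∧ (∀ t, g t ≤ max 0 t) ∧ (∀ t, max 0 t - 2 * ε ≤ g t)) ∧
    ((∀ t, HasDerivAt G (κ t ^ 2) t) ∧ (∀ t ≤ ε, G t = 0) ∧
      (∀ t, 0 ≤ G t) ∧ (∀ t, G t ≤ max 0 t) ∧ (∀ t, max 0 t - 2 * ε ≤ G t)) := by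
  set κ : ℝ → ℝ := fun t => max 0 (min 1 ((t - ε) / ε)) with hκ
  have c : Continuous κ := by rw [hκ]; fun_prop
  have k0 : ∀ t, 0 ≤ κ t := fun t => le_max_left _ _
  have k1 : ∀ t, κ t ≤ 1 := fun t => max_le zero_le_one (min_le_left _ _)
  have kz : ∀ t ≤ ε, κ t = 0 := fun t ht => by
    have : (t - ε) / ε ≤ 0 := div_nonpos_of_nonpos_of_nonneg (by linarith) hε.le
    exact max_eq_left ((min_le_right _ _).trans this)
  have ko : ∀ t, 2 * ε ≤ t → κ t = 1 := fun t ht => by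
    have : 1 ≤ (t - ε) / ε := by rw [le_div_iff₀ hε]; linarith
    simp only [hκ]; rw [min_eq_left this]; simp
  obtain ⟨g, hg⟩ := trunc_one hε κ c k0 k1 kz ko
  obtain ⟨G, hG⟩ := trunc_one hε (fun t => κ t ^ 2) (c.pow 2) (fun t => sq_nonneg _)
    (fun t => pow_le_one₀ (k0 t) (k1 t)) (fun t ht => by simp [kz t ht]) (fun t ht => by simp [ko t ht])
  exact ⟨κ, g, G, c, hg, hG⟩

/-- bounded pointwise convergence of continuous functions on `Ω`. -/
def UC {N : ℕ} (Ω : Set (EuclN N)) (F : ℕ → EuclN N → ℝ) (f : EuclN N → ℝ) : Prop :=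
  (∀ n, ContinuousOn (F n) Ω) ∧ ContinuousOn f Ω ∧ (∃ B, ∀ n, ∀ x ∈ Ω, |F n x| ≤ B) ∧
    ∀ x ∈ Ω, Tendsto (fun n => F n x) atTop (𝓝 (f x))

lemma UC.add {N : ℕ} {Ω : Set (EuclN N)} {F G : ℕ → EuclN N → ℝ} {f g : EuclN N → ℝ}
    (h1 : UC Ω F f) (h2 : UC Ω G g) : UC Ω (fun n x => F n x + G n x) (fun x => f x + g x) := by
  obtain ⟨a1, a2, ⟨A, a3⟩, a4⟩ := h1
  obtain ⟨b1, b2, ⟨B, b3⟩, b4⟩ := h2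
  exact ⟨fun n => (a1 n).add (b1 n), a2.add b2, ⟨A + B, fun n x hx => (abs_add_le _ _).trans
    (add_le_add (a3 n x hx) (b3 n x hx))⟩, fun x hx => (a4 x hx).add (b4 x hx)⟩

lemma UC.mul {N : ℕ} {Ω : Set (EuclN N)} {F G : ℕ → EuclN N → ℝ} {f g : EuclN N → ℝ}
    (h1 : UC Ω F f) (h2 : UC Ω G g) : UC Ω (fun n x => F n x * G n x) (fun x => f x * g x) := by
  obtain ⟨a1, a2, ⟨A, a3⟩, a4⟩ := h1
  obtain ⟨b1, b2, ⟨B, b3⟩, b4⟩ := h2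
  refine ⟨fun n => (a1 n).mul (b1 n), a2.mul b2, ⟨A * B, fun n x hx => ?_⟩,
    fun x hx => (a4 x hx).mul (b4 x hx)⟩
  rw [abs_mul]
  exact mul_le_mul (a3 n x hx) (b3 n x hx) (abs_nonneg _) ((abs_nonneg _).trans (a3 n x hx))

lemma UC.const {N : ℕ} {Ω : Set (EuclN N)} {f : EuclN N → ℝ} (hf : ContinuousOn f Ω) (B : ℝ)
    (hB : ∀ x ∈ Ω, |f x| ≤ B) : UC Ω (fun _ => f) f :=
  ⟨fun _ => hf, hf, ⟨B, fun _ x hx => hB x hx⟩, fun _ _ => tendsto_const_nhds⟩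

lemma UC.real {N : ℕ} {Ω : Set (EuclN N)} (c : ℝ) : UC Ω (fun _ _ => c) (fun _ => c) :=
  UC.const continuousOn_const |c| (fun _ _ => le_rfl)

lemma UC.sub {N : ℕ} {Ω : Set (EuclN N)} {F G : ℕ → EuclN N → ℝ} {f g : EuclN N → ℝ}
    (h1 : UC Ω F f) (h2 : UC Ω G g) : UC Ω (fun n x => F n x - G n x) (fun x => f x - g x) := by
  simpa [sub_eq_add_neg] using h1.add ((UC.real (-1)).mul h2)

lemma UC.sum {N : ℕ} {Ω : Set (EuclN N)} {ι : Type*} [Fintype ι] {F : ι → ℕ → EuclN N → ℝ}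
    {f : ι → EuclN N → ℝ} (h : ∀ i, UC Ω (F i) (f i)) :
    UC Ω (fun n x => ∑ i, F i n x) (fun x => ∑ i, f i x) := by
  classical
  have : ∀ s : Finset ι, UC Ω (fun n x => ∑ i ∈ s, F i n x) (fun x => ∑ i ∈ s, f i x) := by
    intro s
    induction s using Finset.induction_on with
    | empty => simpa using UC.real 0
    | insert a s ha ih => simpa [Finset.sum_insert ha] using (h a).add ih
  exact this _

lemma UC.intg {N : ℕ} {Ω : Set (EuclN N)} (hΩ : IsOpen Ω) (hv : volume Ω ≠ ∞)
    {F : ℕ → EuclN N → ℝ} {f : EuclN N → ℝ}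
    (h : UC Ω F f) (n : ℕ) : IntegrableOn (F n) Ω := by
  obtain ⟨a1, a2, ⟨A, a3⟩, a4⟩ := h
  have : IsFiniteMeasure (volume.restrict Ω) := ⟨by simpa using hv.lt_top⟩
  exact Integrable.of_bound ((a1 n).aestronglyMeasurable hΩ.measurableSet) A
    ((ae_restrict_iff' hΩ.measurableSet).2 (Eventually.of_forall fun x hx => a3 n x hx))

lemma UC.lim_const {N : ℕ} {Ω : Set (EuclN N)}
    {F : ℕ → EuclN N → ℝ} {f : EuclN N → ℝ}
    (h : UC Ω F f) : UC Ω (fun _ => f) f := by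
  obtain ⟨a1, a2, ⟨A, a3⟩, a4⟩ := h
  exact UC.const a2 A fun x hx => le_of_tendsto' (a4 x hx).abs fun n => a3 n x hx

lemma UC.tend {N : ℕ} {Ω : Set (EuclN N)} (hΩ : IsOpen Ω) (hv : volume Ω ≠ ∞)
    {F : ℕ → EuclN N → ℝ} {f : EuclN N → ℝ}
    (h : UC Ω F f) : Tendsto (fun n => ∫ x in Ω, F n x) atTop (𝓝 (∫ x in Ω, f x)) := by
  obtain ⟨a1, a2, ⟨A, a3⟩, a4⟩ := h
  refine tendsto_integral_of_dominated_convergence (fun _ => A) ?_ ?_ ?_ ?_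
  · exact fun n => (a1 n).aestronglyMeasurable hΩ.measurableSet
  · have : IsFiniteMeasure (volume.restrict Ω) := ⟨by simpa using hv.lt_top⟩
    exact integrable_const A
  · exact fun n => (ae_restrict_iff' hΩ.measurableSet).2 (Eventually.of_forall fun x hx => a3 n x hx)
  · exact (ae_restrict_iff' hΩ.measurableSet).2 (Eventually.of_forall fun x hx => a4 x hx)

end

section
open MeasureTheory Real Set
open scoped RealInnerProductSpace ENNReal
open scoped Topology
open Filter

lemma comp_C1 {N : ℕ} {Ω : Set (EuclN N)} (hΩ : IsOpen Ω) (hb : Bornology.IsBounded Ω)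
    {ε : ℝ} (hε : 0 < ε) {κ g : ℝ → ℝ} (hκ : Continuous κ) (hg : ∀ t, HasDerivAt g (κ t) t)
    (hgz : ∀ t ≤ ε, g t = 0) {V : EuclN N → ℝ} (hV : Continuous V) (hV0 : ∀ x ∉ Ω, V x = 0)
    (hV1 : ContDiffOn ℝ 1 V Ω) :
    ContDiff ℝ 1 (fun x => g (V x)) ∧ HasCompactSupport (fun x => g (V x)) ∧
      tsupport (fun x => g (V x)) ⊆ Ω ∧
      ∀ x ∈ Ω, ∀ k, pD k (fun x => g (V x)) x = κ (V x) * pD k V x := by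
  have hs : tsupport (fun x => g (V x)) ⊆ {x | ε ≤ V x} := by
    refine closure_minimal ?_ (isClosed_le continuous_const hV)
    intro x hx
    by_contra h
    exact hx (hgz _ (not_le.1 h).le)
  have hs2 : {x | ε ≤ V x} ⊆ Ω := by
    intro x hx
    by_contra h
    have h2 : ε ≤ V x := hx
    rw [hV0 x h] at h2
    linarith
  have hg1 : ContDiff ℝ 1 g := by
    rw [contDiff_one_iff_deriv]
    refine ⟨fun t => (hg t).differentiableAt, ?_⟩
    rw [show deriv g = κ from funext fun t => (hg t).deriv]
    exact hκ
  have hsΩ := hs.trans hs2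
  refine ⟨?_, ?_, hsΩ, ?_⟩
  · rw [contDiff_iff_contDiffAt]
    intro x
    by_cases hx : x ∈ Ω
    · exact hg1.contDiffAt.comp x (hV1.contDiffAt (hΩ.mem_nhds hx))
    · have : (fun x => g (V x)) =ᶠ[𝓝 x] fun _ => 0 :=
        notMem_tsupport_iff_eventuallyEq.1 (fun h => hx (hsΩ h))
      exact contDiffAt_const.congr_of_eventuallyEq this
  · exact Metric.isCompact_of_isClosed_isBounded (isClosed_tsupport _) (hb.subset hsΩ)
  · intro x hx k
    have hd : DifferentiableAt ℝ V x :=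
      (hV1.contDiffAt (hΩ.mem_nhds hx)).differentiableAt (by norm_num)
    have := ((hg (V x)).comp_hasFDerivAt x hd.hasFDerivAt).fderiv
    unfold pD
    rw [show (fun x => g (V x)) = g ∘ V from rfl, this]
    simp

lemma grad_j {N : ℕ} {Ω : Set (EuclN N)} (hΩ : IsOpen Ω) (hb : Bornology.IsBounded Ω)
    {ε : ℝ} (hε : 0 < ε) {κ g G : ℝ → ℝ} (hκ : Continuous κ) (hg : ∀ t, HasDerivAt g (κ t) t)
    (hgz : ∀ t ≤ ε, g t = 0) (hG : ∀ t, HasDerivAt G (κ t ^ 2) t)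
    (hGz : ∀ t ≤ ε, G t = 0) {V h : EuclN N → ℝ} (hV : Continuous V) (hV0 : ∀ x ∉ Ω, V x = 0)
    (hV1 : ContDiffOn ℝ 1 V Ω) (hh : ContinuousOn h Ω)
    (hw : ∀ φ : EuclN N → ℝ, ContDiff ℝ 1 φ → HasCompactSupport φ → tsupport φ ⊆ Ω →
      ∫ x, ∑ k, pD k V x * pD k φ x = ∫ x, h x * φ x)
    {φ : EuclN N → ℝ} (p1 : ContDiff ℝ 1 φ) (p2 : HasCompactSupport φ) (p3 : tsupport φ ⊆ Ω)
    (p4 : ∀ k, ContDiff ℝ 1 (pD k φ)) (c : ℝ) :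
    IntegrableOn (fun x => ‖gradient (fun x => g (V x) + c * φ x) x‖ ^ 2) Ω ∧
    ∫ x in Ω, ‖gradient (fun x => g (V x) + c * φ x) x‖ ^ 2 =
      ∫ x in Ω, (h x * G (V x) + (-2 * c) * (g (V x) * ∑ k, pD k (pD k φ) x)
        + c ^ 2 * ∑ k, pD k φ x ^ 2) := by
  obtain ⟨g1, g2, g3, g4⟩ := comp_C1 hΩ hb hε hκ hg hgz hV hV0 hV1
  obtain ⟨G1, G2, G3, G4⟩ := comp_C1 (κ := fun t => κ t ^ 2) hΩ hb hε (hκ.pow 2) hG hGz hV hV0 hV1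
  have q2 : ∀ k, HasCompactSupport (pD k φ) := fun k => pD_csupp p2 k
  have q3 : ∀ k, tsupport (pD k φ) ⊆ Ω := fun k => (pD_supp k).trans p3
  have r2 : ∀ k, HasCompactSupport (pD k (pD k φ)) := fun k => pD_csupp (q2 k) k
  have r3 : ∀ k, tsupport (pD k (pD k φ)) ⊆ Ω := fun k => (pD_supp k).trans (q3 k)
  -- integrability
  have i1 : ∀ k, Integrable (fun x => pD k V x * pD k (fun x => G (V x)) x) := fun k =>
    intg_mul_supp hΩ (pD_contOn hΩ hV1 k) (pD_cont G1 k) (pD_csupp G2 k) ((pD_supp k).trans G3)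
  have i2 : ∀ k, Integrable (fun x => pD k (fun x => g (V x)) x * pD k φ x) := fun k =>
    intg_mul_supp hΩ (pD_cont g1 k).continuousOn (pD_cont p1 k) (q2 k) (q3 k)
  have i3 : ∀ k, Integrable (fun x => pD k φ x * pD k φ x) := fun k =>
    intg_mul_supp hΩ (pD_cont p1 k).continuousOn (pD_cont p1 k) (q2 k) (q3 k)
  have i4 : Integrable (fun x => h x * G (V x)) := intg_mul_supp hΩ hh G1.continuous G2 G3
  have i5 : ∀ k, Integrable (fun x => g (V x) * pD k (pD k φ) x) := fun k =>
    intg_mul_supp hΩ g1.continuous.continuousOn (pD_cont (p4 k) k) (r2 k) (r3 k)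
  have pt : ∀ x ∈ Ω, ‖gradient (fun x => g (V x) + c * φ x) x‖ ^ 2 =
      (∑ k, pD k V x * pD k (fun x => G (V x)) x)
      + (2 * c) * (∑ k, pD k (fun x => g (V x)) x * pD k φ x)
      + c ^ 2 * ∑ k, pD k φ x * pD k φ x := by
    intro x hx
    rw [norm_gradient_sq, Finset.mul_sum, Finset.mul_sum, ← Finset.sum_add_distrib,
      ← Finset.sum_add_distrib]
    refine Finset.sum_congr rfl fun k _ => ?_
    have : pD k (fun x => g (V x) + c * φ x) x = pD k (fun x => g (V x)) x + c * pD k φ x := by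
      unfold pD
      have d1 : DifferentiableAt ℝ (fun x => g (V x)) x := g1.differentiable (by norm_num) x
      have d2 : DifferentiableAt ℝ φ x := p1.differentiable (by norm_num) x
      have := (d1.hasFDerivAt.add (d2.hasFDerivAt.const_mul c)).fderiv
      rw [show (fun x => g (V x) + c * φ x) = (fun x => g (V x)) + (fun x => c * φ x) from rfl, this]
      simp
    rw [this, g4 x hx k, G4 x hx k]
    ring
  have I1 : Integrable (fun x => ∑ k, pD k V x * pD k (fun x => G (V x)) x) :=
    integrable_finsetSum _ fun k _ => i1 k
  have I2 : Integrable (fun x => ∑ k, pD k (fun x => g (V x)) x * pD k φ x) :=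
    integrable_finsetSum _ fun k _ => i2 k
  have I3 : Integrable (fun x => ∑ k, pD k φ x * pD k φ x) :=
    integrable_finsetSum _ fun k _ => i3 k
  have I5 : Integrable (fun x => g (V x) * ∑ k, pD k (pD k φ) x) := by
    simp_rw [Finset.mul_sum]
    exact integrable_finsetSum _ fun k _ => i5 k
  have A1 : ∫ x, ∑ k, pD k V x * pD k (fun x => G (V x)) x = ∫ x, h x * G (V x) :=
    hw _ G1 G2 G3
  have A2 : ∫ x, ∑ k, pD k (fun x => g (V x)) x * pD k φ x
      = - ∫ x, g (V x) * ∑ k, pD k (pD k φ) x := by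
    simp_rw [Finset.mul_sum]
    rw [integral_finsetSum _ fun k _ => i2 k, integral_finsetSum _ fun k _ => i5 k,
      ← Finset.sum_neg_distrib]
    refine Finset.sum_congr rfl fun k _ => ?_
    rw [ibp hΩ g1.contDiffOn (p4 k) (q2 k) (q3 k) k, neg_neg]
  have z : ∀ {a b : EuclN N → ℝ}, tsupport b ⊆ Ω → ∀ x ∉ Ω, a x * b x = 0 := by
    intro a b hb x hx
    rw [image_eq_zero_of_notMem_tsupport (fun h => hx (hb h)), mul_zero]
  have S : ∀ {a : EuclN N → ℝ}, (∀ x ∉ Ω, a x = 0) → ∫ x in Ω, a x = ∫ x, a x := fun ha =>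
    setIntegral_eq_integral_of_forall_compl_eq_zero ha
  have B1 := S (a := fun x => ∑ k, pD k V x * pD k (fun x => G (V x)) x)
    (fun x hx => Finset.sum_eq_zero fun k _ => z (a := pD k V) ((pD_supp k).trans G3) x hx)
  have B2 := S (a := fun x => ∑ k, pD k (fun x => g (V x)) x * pD k φ x)
    (fun x hx => Finset.sum_eq_zero fun k _ => z (a := pD k (fun x => g (V x))) (q3 k) x hx)
  have B4 := S (a := fun x => h x * G (V x)) (fun x hx => z (a := h) (b := fun x => G (V x)) G3 x hx)
  have B5 := S (a := fun x => g (V x) * ∑ k, pD k (pD k φ) x) (fun x hx => by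
    rw [Finset.mul_sum]
    exact Finset.sum_eq_zero fun k _ => z (a := fun x => g (V x)) (r3 k) x hx)
  have J1 := I1.integrableOn (s := Ω)
  have J2 := (I2.const_mul (2 * c)).integrableOn (s := Ω)
  have J3 := (I3.const_mul (c ^ 2)).integrableOn (s := Ω)
  have J12 : IntegrableOn (fun x => (∑ k, pD k V x * pD k (fun x => G (V x)) x)
      + (2 * c) * (∑ k, pD k (fun x => g (V x)) x * pD k φ x)) Ω := J1.add J2
  have J4 := i4.integrableOn (s := Ω)
  have J5 := (I5.const_mul (-2 * c)).integrableOn (s := Ω)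
  have J45 : IntegrableOn (fun x => h x * G (V x) + (-2 * c) * (g (V x) * ∑ k, pD k (pD k φ) x)) Ω :=
    J4.add J5
  constructor
  · exact ((J1.add J2).add J3).congr_fun (fun x hx => (pt x hx).symm) hΩ.measurableSet
  · rw [setIntegral_congr_fun hΩ.measurableSet (fun x hx => pt x hx)]
    simp_rw [pow_two (pD _ φ _)]
    rw [integral_add J12 J3, integral_add J1 J2, integral_add J45 J3,
      integral_add J4 J5, integral_const_mul (2 * c), integral_const_mul (-2 * c), B1, B2, B4, B5, A1, A2]
    ring

lemma core_alg {m : ℕ} (J : Fin m → Fin m → ℝ) (v : Fin m → ℝ) (i : Fin m) (K L D φ t : ℝ)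
    (ht : 0 < t) (hφ : 0 ≤ φ) (hJK : ∀ i j, |J i j| ≤ K) (hJ0 : ∀ i j, i ≠ j → 0 ≤ J i j)
    (c : Fin m → ℝ) (hc : c = fun j => if j = i then t else 0) :
    (∑ j, ((∑ l, J j l * v l) * max 0 (v j) + (-2 * c j) * (max 0 (v j) * L) + c j ^ 2 * D))
      - ∑ j, ∑ l, J j l * (max 0 (v j) + c j * φ) * (max 0 (v l) + c l * φ) ≤
    t * (-2 * (max 0 (v i) * L) + 2 * K * (max 0 (v i) * φ)) + t ^ 2 * (D + K * (φ * φ)) := by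
  have hp : ∀ j, 0 ≤ max 0 (v j) := fun j => le_max_left _ _
  have hvp : ∀ j, v j ≤ max 0 (v j) := fun j => le_max_right _ _
  have hpp : ∀ j, v j * max 0 (v j) = max 0 (v j) * max 0 (v j) := fun j => by
    rcases le_total 0 (v j) with h | h
    · rw [max_eq_right h]
    · rw [max_eq_left h]; ring
  generalize hP : (fun j => max 0 (v j)) = p at *
  have hP' : ∀ j, max 0 (v j) = p j := fun j => congrFun hP j
  simp only [hP'] at *
  have c0 : ∀ j, 0 ≤ c j := fun j => by rw [hc]; dsimp only; split_ifs <;> linarith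
  have e1 : ∑ j, (-2 * c j) * (p j * L) = -2 * t * (p i * L) := by
    rw [Finset.sum_eq_single i]
    · simp [hc]
    · intro b _ hb; simp [hc, hb]
    · simp
  have e2 : ∑ j, c j ^ 2 * D = t ^ 2 * D := by
    rw [Finset.sum_eq_single i]
    · simp [hc]
    · intro b _ hb; simp [hc, hb]
    · simp
  have e3 : ∑ j, ∑ l, (if j = i ∧ l = i then 2 * K * t * (p i * φ) + K * t ^ 2 * (φ * φ) else 0)
      = 2 * K * t * (p i * φ) + K * t ^ 2 * (φ * φ) := by
    rw [Finset.sum_eq_single i]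
    · rw [Finset.sum_eq_single i]
      · simp
      · intro b _ hb; simp [hb]
      · simp
    · intro b _ hb; simp [hb]
    · simp
  have e4 : ∑ j, ∑ l, (J j l * v l * p j - J j l * (p j + c j * φ) * (p l + c l * φ)) ≤
      ∑ j, ∑ l, (if j = i ∧ l = i then 2 * K * t * (p i * φ) + K * t ^ 2 * (φ * φ) else 0) := by
    refine Finset.sum_le_sum fun j _ => Finset.sum_le_sum fun l _ => ?_
    by_cases hjl : j = l
    · subst hjl
      by_cases hj : j = i
      · subst hj
        have hcj : c j = t := by simp [hc]
        simp only [and_self, if_true, hcj]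
        have := neg_le_of_abs_le (hJK j j)
        have q : 0 ≤ 2 * t * (p j * φ) + t ^ 2 * (φ * φ) := by
          have := hp j
          positivity
        have e : J j j * v j * p j - J j j * (p j + t * φ) * (p j + t * φ) =
          - J j j * (2 * t * (p j * φ) + t ^ 2 * (φ * φ)) := by
          rw [mul_assoc, hpp j]; ring
        rw [e]
        nlinarith
      · have hcj : c j = 0 := by simp [hc, hj]
        simp only [hj, false_and, if_false, hcj]
        rw [mul_assoc, hpp j]
        apply le_of_eq; ring
    · have : ¬ (j = i ∧ l = i) := fun h => hjl (h.1.trans h.2.symm)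
      rw [if_neg this]
      have a := hJ0 j l hjl
      have b : v l * p j ≤ (p j + c j * φ) * (p l + c l * φ) := by
        have h1 : v l * p j ≤ p l * p j := mul_le_mul_of_nonneg_right (hvp l) (hp j)
        have h2 := mul_nonneg (c0 j) hφ
        have h3 := mul_nonneg (c0 l) hφ
        have := mul_nonneg (hp j) h3
        have := mul_nonneg h2 (hp l)
        have := mul_nonneg h2 h3
        nlinarith
      have := mul_le_mul_of_nonneg_left b a
      nlinarith
  rw [e3] at e4
  have e5 : (∑ j, ((∑ l, J j l * v l) * p j + (-2 * c j) * (p j * L) + c j ^ 2 * D))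
      - ∑ j, ∑ l, J j l * (p j + c j * φ) * (p l + c l * φ) =
      ∑ j, ∑ l, (J j l * v l * p j - J j l * (p j + c j * φ) * (p l + c l * φ))
      + (∑ j, (-2 * c j) * (p j * L)) + ∑ j, c j ^ 2 * D := by
    simp only [Finset.sum_add_distrib, Finset.sum_sub_distrib, Finset.sum_mul]
    ring
  rw [e5, e1, e2]
  linarith

lemma core {N m : ℕ} {Ω : Set (EuclN N)} (hΩ : IsOpen Ω) (hb : Bornology.IsBounded Ω)
    (J : Fin m → Fin m → EuclN N → ℝ) (hJ : ∀ i j, ContinuousOn (J i j) Ω)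
    (K : ℝ) (hK : 0 ≤ K) (hJK : ∀ i j, ∀ x ∈ Ω, |J i j x| ≤ K)
    (hJ0 : ∀ i j, i ≠ j → ∀ x ∈ Ω, 0 ≤ J i j x)
    (V : Fin m → EuclN N → ℝ) (hV : ∀ i, Continuous (V i)) (hV0 : ∀ i, ∀ x ∉ Ω, V i x = 0)
    (hV1 : ∀ i, ContDiffOn ℝ 1 (V i) Ω)
    (hw : ∀ i, ∀ φ : EuclN N → ℝ, ContDiff ℝ 1 φ → HasCompactSupport φ → tsupport φ ⊆ Ω →
      ∫ x, ∑ k, pD k (V i) x * pD k φ x = ∫ x, (∑ j, J i j x * V j x) * φ x)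
    (hst : ∀ Ψ : Fin m → EuclN N → ℝ, IsTestFun Ω Ψ →
      0 ≤ ∫ x in Ω, ((∑ i, ‖gradient (Ψ i) x‖ ^ 2) - ∑ i, ∑ j, J i j x * Ψ i x * Ψ j x))
    (i : Fin m) {φ : EuclN N → ℝ} (p1 : ContDiff ℝ 1 φ) (p2 : HasCompactSupport φ)
    (p3 : tsupport φ ⊆ Ω) (p0 : ∀ x, 0 ≤ φ x)
    (p4 : ∀ k, ContDiff ℝ 1 (pD k φ)) :
    ∫ x, max 0 (V i x) * ∑ k, pD k (pD k φ) x ≤ K * ∫ x, max 0 (V i x) * φ x := by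
  have hv : volume Ω ≠ ∞ := hb.measure_lt_top.ne
  have bd : ∀ F : EuclN N → ℝ, Continuous F → ∃ B, ∀ x ∈ Ω, |F x| ≤ B := by
    intro F hF
    obtain ⟨B, hB⟩ := hb.isCompact_closure.exists_bound_of_continuousOn hF.continuousOn
    exact ⟨B, fun x hx => hB x (subset_closure hx)⟩
  have uc : ∀ F : EuclN N → ℝ, Continuous F → UC Ω (fun _ => F) F := by
    intro F hF
    obtain ⟨B, hB⟩ := bd F hF
    exact UC.const hF.continuousOn B hB
  have ucJ : ∀ i j, UC Ω (fun _ => J i j) (J i j) := fun i j => UC.const (hJ i j) K (hJK i j)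
  have hε : ∀ n : ℕ, 0 < 1 / ((n : ℝ) + 1) := fun n => by positivity
  choose κ g G hκ hg hG using fun n : ℕ => trunc (hε n)
  have e0 : Tendsto (fun n : ℕ => 2 * (1 / ((n : ℝ) + 1))) atTop (𝓝 0) := by
    simpa using tendsto_one_div_add_atTop_nhds_zero_nat.const_mul (2 : ℝ)
  have ucg : ∀ H h : ℕ → ℝ → ℝ, (∀ n, (∀ t, HasDerivAt (H n) (h n t) t) ∧
      (∀ t ≤ 1 / ((n : ℝ) + 1), H n t = 0) ∧
      (∀ t, 0 ≤ H n t) ∧ (∀ t, H n t ≤ max 0 t) ∧ (∀ t, max 0 t - 2 * (1 / ((n : ℝ) + 1)) ≤ H n t)) →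
      ∀ j, UC Ω (fun n x => H n (V j x)) (fun x => max 0 (V j x)) := by
    intro H h hH j
    have cm : Continuous fun x => max 0 (V j x) := continuous_const.max (hV j)
    obtain ⟨B, hB⟩ := bd _ cm
    refine ⟨fun n => ?_, cm.continuousOn, ⟨B, fun n x hx => ?_⟩, fun x hx => ?_⟩
    · have : Continuous (H n) := continuous_iff_continuousAt.2 fun t => ((hH n).1 t).continuousAt
      exact (this.comp (hV j)).continuousOn
    · rw [abs_of_nonneg ((hH n).2.2.1 _)]
      exact ((hH n).2.2.2.1 _).trans ((le_abs_self _).trans (hB x hx))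
    · refine tendsto_of_tendsto_of_tendsto_of_le_of_le
        (g := fun n : ℕ => max 0 (V j x) - 2 * (1 / ((n : ℝ) + 1))) (h := fun _ => max 0 (V j x))
        ?_ tendsto_const_nhds (fun n => (hH n).2.2.2.2 _) (fun n => (hH n).2.2.2.1 _)
      simpa using tendsto_const_nhds.sub e0
  have u1 := ucg g κ hg
  have u2 := ucg G (fun n t => κ n t ^ 2) hG
  have cL : Continuous fun x => ∑ k, pD k (pD k φ) x :=
    continuous_finsetSum _ fun k _ => pD_cont (p4 k) k
  have cD : Continuous fun x => ∑ k, pD k φ x ^ 2 :=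
    continuous_finsetSum _ fun k _ => (pD_cont p1 k).pow 2
  have uL := uc _ cL
  have uD := uc _ cD
  have uφ := uc _ p1.continuous
  have uV := fun j => uc _ (hV j)
  have hh : ∀ j, UC Ω (fun _ x => ∑ l, J j l x * V l x) (fun x => ∑ l, J j l x * V l x) :=
    fun j => UC.sum fun l => (ucJ j l).mul (uV l)
  have main : ∀ t : ℝ, 0 < t → 0 ≤ ∫ x in Ω, (t * (-2 * (max 0 (V i x) * ∑ k, pD k (pD k φ) x)
      + 2 * K * (max 0 (V i x) * φ x)) + t ^ 2 * ((∑ k, pD k φ x ^ 2) + K * φ x ^ 2)) := by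
    intro t ht
    set c : Fin m → ℝ := fun j => if j = i then t else 0 with hc
    have ucF := (UC.sum fun j => (((hh j).mul (u2 j)).add ((UC.real (-2 * c j)).mul ((u1 j).mul uL))).add
      ((UC.real (c j ^ 2)).mul uD)).sub (UC.sum fun j => UC.sum fun l =>
        ((ucJ j l).mul ((u1 j).add ((UC.real (c j)).mul uφ))).mul ((u1 l).add ((UC.real (c l)).mul uφ)))
    have nn : ∀ n, 0 ≤ ∫ x in Ω, ((∑ j, ((∑ l, J j l x * V l x) * G n (V j x)
        + (-2 * c j) * (g n (V j x) * ∑ k, pD k (pD k φ) x) + c j ^ 2 * ∑ k, pD k φ x ^ 2))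
        - ∑ j, ∑ l, J j l x * (g n (V j x) + c j * φ x) * (g n (V l x) + c l * φ x)) := by
      intro n
      have gj := fun j => grad_j hΩ hb (hε n) (hκ n) (hg n).1 (hg n).2.1 (hG n).1 (hG n).2.1 (hV j)
        (hV0 j) (hV1 j) (hh j).2.1 (hw j) p1 p2 p3 p4 (c j)
      have t0 := hst (fun j x => g n (V j x) + c j * φ x) (fun j => by
        obtain ⟨g1, g2, g3, g4⟩ := comp_C1 hΩ hb (hε n) (hκ n) (hg n).1 (hg n).2.1 (hV j) (hV0 j) (hV1 j)
        have hcs : HasCompactSupport (fun x => c j * φ x) :=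
          HasCompactSupport.mul_left (f := fun _ => c j) (f' := φ) p2
        have hts : tsupport (fun x => c j * φ x) ⊆ tsupport φ :=
          tsupport_mul_subset_right (f := fun _ => c j) (g := φ)
        refine ⟨g1.add (contDiff_const.mul p1), g2.add hcs, ?_⟩
        exact (tsupport_add (fun x => g n (V j x)) (fun x => c j * φ x)).trans
          (union_subset g3 (hts.trans p3)))
      have uA : UC Ω (fun n x => ∑ j, ((∑ l, J j l x * V l x) * G n (V j x)
        + (-2 * c j) * (g n (V j x) * ∑ k, pD k (pD k φ) x) + c j ^ 2 * ∑ k, pD k φ x ^ 2)) _ :=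
        (UC.sum fun j => (((hh j).mul (u2 j)).add ((UC.real (-2 * c j)).mul ((u1 j).mul uL))).add
          ((UC.real (c j ^ 2)).mul uD))
      have uAj := fun j => ((((hh j).mul (u2 j)).add ((UC.real (-2 * c j)).mul ((u1 j).mul uL))).add
          ((UC.real (c j ^ 2)).mul uD)).intg hΩ hv n
      have uB : UC Ω (fun n x => ∑ j, ∑ l, J j l x * (g n (V j x) + c j * φ x) * (g n (V l x) + c l * φ x)) _ :=
        (UC.sum fun j => UC.sum fun l =>
        ((ucJ j l).mul ((u1 j).add ((UC.real (c j)).mul uφ))).mul ((u1 l).add ((UC.real (c l)).mul uφ)))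
      have iB := uB.intg hΩ hv n
      have iA := uA.intg hΩ hv n
      have iS : IntegrableOn (fun x => ∑ j, ‖gradient (fun x => g n (V j x) + c j * φ x) x‖ ^ 2) Ω :=
        integrable_finsetSum _ fun j _ => (gj j).1
      rw [integral_sub iS iB, integral_finsetSum _ (fun j _ => (gj j).1)] at t0
      rw [integral_sub iA iB, integral_finsetSum _ (fun j _ => uAj j)]
      simp_rw [fun j => (gj j).2] at t0
      exact t0
    have lim := ge_of_tendsto' (ucF.tend hΩ hv) nn
    refine lim.trans ?_
    have iF := ucF.lim_const.intg hΩ hv 0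
    have uR := (((UC.real t).mul (((UC.real (-2)).mul ((u1 i).mul uL)).add
      ((UC.real (2 * K)).mul ((u1 i).mul uφ)))).add ((UC.real (t ^ 2)).mul (uD.add ((UC.real K).mul (uφ.mul uφ))))).lim_const.intg hΩ hv 0
    simp_rw [pow_two (φ _)]
    refine setIntegral_mono_on iF uR hΩ.measurableSet fun x hx => ?_
    exact core_alg (fun j l => J j l x) (fun j => V j x) i K (∑ k, pD k (pD k φ) x)
      (∑ k, pD k φ x ^ 2) (φ x) t ht (p0 x) (fun a b => hJK a b x hx) (fun a b h => hJ0 a b h x hx) c hc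
  have iL := ((u1 i).mul uL).lim_const.intg hΩ hv 0
  have iφ := ((u1 i).mul uφ).lim_const.intg hΩ hv 0
  have iB : IntegrableOn (fun x => -2 * (max 0 (V i x) * ∑ k, pD k (pD k φ) x)
      + 2 * K * (max 0 (V i x) * φ x)) Ω := (iL.const_mul (-2)).add (iφ.const_mul (2 * K))
  have iC : IntegrableOn (fun x => (∑ k, pD k φ x ^ 2) + K * φ x ^ 2) Ω := by
    simp_rw [pow_two (φ _)]
    exact (uD.add ((UC.real K).mul (uφ.mul uφ))).intg hΩ hv 0
  have hB : 0 ≤ ∫ x in Ω, (-2 * (max 0 (V i x) * ∑ k, pD k (pD k φ) x)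
      + 2 * K * (max 0 (V i x) * φ x)) := by
    set b := ∫ x in Ω, (-2 * (max 0 (V i x) * ∑ k, pD k (pD k φ) x)
      + 2 * K * (max 0 (V i x) * φ x)) with hbdef
    set d := ∫ x in Ω, ((∑ k, pD k φ x ^ 2) + K * φ x ^ 2) with hd
    have m2 : ∀ t : ℝ, 0 < t → 0 ≤ t * b + t ^ 2 * d := by
      intro t ht
      have := main t ht
      rwa [integral_add (iB.const_mul t) (iC.const_mul (t ^ 2)), integral_const_mul,
        integral_const_mul] at this
    by_contra hneg
    push Not at hneg
    have hq : 0 < -b / (2 * (|d| + 1)) := div_pos (by linarith) (by positivity)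
    have h1 := m2 _ hq
    have h2 : 0 ≤ b + (-b / (2 * (|d| + 1))) * d := by
      have : 0 ≤ (-b / (2 * (|d| + 1))) * (b + (-b / (2 * (|d| + 1))) * d) := by linarith
      exact nonneg_of_mul_nonneg_right this hq
    have h3 : (-b / (2 * (|d| + 1))) * d ≤ -b / 2 := by
      have : (-b / (2 * (|d| + 1))) * d ≤ (-b / (2 * (|d| + 1))) * (|d| + 1) :=
        mul_le_mul_of_nonneg_left (by linarith [le_abs_self d]) hq.le
      refine this.trans (le_of_eq ?_)
      have : |d| + 1 ≠ 0 := by positivity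
      field_simp
    linarith
  rw [integral_add (iL.const_mul (-2)) (iφ.const_mul (2 * K)), integral_const_mul,
    integral_const_mul, setIntegral_eq_integral_of_forall_compl_eq_zero,
    setIntegral_eq_integral_of_forall_compl_eq_zero] at hB
  · linarith
  · intro x hx; simp [hV0 i x hx]
  · intro x hx; simp [hV0 i x hx]

end

section
open MeasureTheory Real Set
open scoped RealInnerProductSpace ENNReal
open scoped Topology
open Filter

noncomputable def rA {N : ℕ} (a b : EuclN N) : EuclN N →L[ℝ] EuclN N :=
  (innerSL ℝ a).smulRight b - (innerSL ℝ b).smulRight a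

lemma rA_apply {N : ℕ} (a b x : EuclN N) : rA a b x = ⟪a, x⟫ • b - ⟪b, x⟫ • a := by
  simp [rA]

/-- orthonormal pair -/
def OP {N : ℕ} (a b : EuclN N) : Prop := ‖a‖ = 1 ∧ ‖b‖ = 1 ∧ ⟪a, b⟫ = 0

lemma OP.inn {N : ℕ} {a b : EuclN N} (h : OP a b) : ⟪a, a⟫ = 1 ∧ ⟪b, b⟫ = 1 ∧ ⟪a, b⟫ = 0 ∧ ⟪b, a⟫ = 0 := by
  obtain ⟨h1, h2, h3⟩ := h
  refine ⟨by rw [real_inner_self_eq_norm_sq, h1]; norm_num, by rw [real_inner_self_eq_norm_sq, h2]; norm_num, h3, by rw [real_inner_comm, h3]⟩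

lemma rA_sq {N : ℕ} {a b : EuclN N} (h : OP a b) (x : EuclN N) :
    rA a b (rA a b x) = - (⟪a, x⟫ • a) - ⟪b, x⟫ • b := by
  obtain ⟨h1, h2, h3, h4⟩ := h.inn
  simp only [rA_apply, inner_sub_right, inner_smul_right, h1, h2, h3, h4]
  simp
  abel

lemma rA_cube {N : ℕ} {a b : EuclN N} (h : OP a b) (x : EuclN N) :
    rA a b (rA a b (rA a b x)) = - rA a b x := by
  obtain ⟨h1, h2, h3, h4⟩ := h.inn
  rw [rA_sq h]
  simp only [rA_apply, inner_sub_right, inner_smul_right, h1, h2, h3, h4]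
  simp

lemma rA_skew {N : ℕ} (a b x y : EuclN N) : ⟪rA a b x, y⟫ = - ⟪x, rA a b y⟫ := by
  simp only [rA_apply, inner_sub_right, inner_sub_left, inner_smul_right, inner_smul_left]
  rw [real_inner_comm b x, real_inner_comm a x]
  simp
  ring

noncomputable def rR {N : ℕ} (a b : EuclN N) (θ : ℝ) : EuclN N →L[ℝ] EuclN N :=
  ContinuousLinearMap.id ℝ _ + (1 - cos θ) • ((rA a b).comp (rA a b)) + sin θ • rA a b

lemma rR_apply {N : ℕ} (a b : EuclN N) (θ : ℝ) (x : EuclN N) :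
    rR a b θ x = x + (1 - cos θ) • rA a b (rA a b x) + sin θ • rA a b x := by
  simp [rR]

lemma rR_zero {N : ℕ} (a b x : EuclN N) : rR a b 0 x = x := by simp [rR_apply]
lemma rR_two_pi {N : ℕ} (a b x : EuclN N) : rR a b (2 * π) x = x := by simp [rR_apply]

lemma rA_rR {N : ℕ} {a b : EuclN N} (h : OP a b) (θ : ℝ) (x : EuclN N) :
    rA a b (rR a b θ x) = cos θ • rA a b x + sin θ • rA a b (rA a b x) := by
  rw [rR_apply, map_add, map_add, map_smul, map_smul, rA_cube h]
  module

lemma rR_inv {N : ℕ} {a b : EuclN N} (h : OP a b) (θ : ℝ) (x : EuclN N) :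
    rR a b (-θ) (rR a b θ x) = x := by
  rw [rR_apply a b (-θ), rA_rR h, map_add, map_smul, map_smul, rA_cube h, rR_apply]
  simp only [cos_neg, sin_neg]
  have e : sin θ * sin θ = 1 - cos θ * cos θ := by nlinarith [sin_sq_add_cos_sq θ]
  match_scalars
  · ring
  · nlinarith
  · nlinarith

lemma rR_inner {N : ℕ} {a b : EuclN N} (θ : ℝ) (x y : EuclN N) :
    ⟪rR a b θ x, y⟫ = ⟪x, rR a b (-θ) y⟫ := by
  simp only [rR_apply, inner_add_left, inner_add_right, inner_smul_left, inner_smul_right, rA_skew,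
    cos_neg, sin_neg]
  simp

noncomputable def rI {N : ℕ} {a b : EuclN N} (h : OP a b) (θ : ℝ) : EuclN N ≃ₗᵢ[ℝ] EuclN N where
  toLinearEquiv := LinearEquiv.ofLinearMap (rR a b θ : EuclN N →ₗ[ℝ] EuclN N)
    (rR a b (-θ) : EuclN N →ₗ[ℝ] EuclN N)
    (by ext1 x; simpa using rR_inv h (-θ) x) (by ext1 x; simpa using rR_inv h θ x)
  norm_map' := fun x => by
    have : ‖rR a b θ x‖ ^ 2 = ‖x‖ ^ 2 := by
      rw [← real_inner_self_eq_norm_sq, rR_inner, rR_inv h, real_inner_self_eq_norm_sq]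
    simpa using (pow_left_inj₀ (norm_nonneg _) (norm_nonneg _) two_ne_zero).1 this

lemma rI_apply {N : ℕ} {a b : EuclN N} (h : OP a b) (θ : ℝ) (x : EuclN N) : rI h θ x = rR a b θ x := rfl
lemma rI_symm {N : ℕ} {a b : EuclN N} (h : OP a b) (θ : ℝ) (x : EuclN N) : (rI h θ).symm x = rR a b (-θ) x := rfl

lemma rR_norm {N : ℕ} {a b : EuclN N} (h : OP a b) (θ : ℝ) (x : EuclN N) : ‖rR a b θ x‖ = ‖x‖ :=
  (rI h θ).norm_map x

lemma rR_deriv {N : ℕ} {a b : EuclN N} (h : OP a b) (θ : ℝ) (x : EuclN N) :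
    HasDerivAt (fun t => rR a b t x) (rA a b (rR a b θ x)) θ := by
  have h1 := (((hasDerivAt_cos θ).const_sub 1).smul_const (rA a b (rA a b x)))
  have h2 := ((hasDerivAt_sin θ).smul_const (rA a b x))
  have h3 := ((hasDerivAt_const θ x).add h1).add h2
  have e : (fun t => rR a b t x) = ((fun _ => x) + (fun t => (1 - cos t) • rA a b (rA a b x)))
      + (fun t => sin t • rA a b x) := by
    funext t; simp [rR_apply]
  have e2 : rA a b (rR a b θ x) = 0 + - -sin θ • (rA a b) ((rA a b) x) + cos θ • (rA a b) x := by
    rw [rA_rR h]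
    module
  rw [e, e2]
  exact h3

lemma rR_cont {N : ℕ} (a b : EuclN N) : Continuous (fun p : ℝ × EuclN N => rR a b p.1 p.2) := by
  simp only [rR_apply]
  fun_prop

def NInv {N : ℕ} (Ω : Set (EuclN N)) : Prop := ∀ x ∈ Ω, ∀ y, ‖y‖ = ‖x‖ → y ∈ Ω

lemma NInv.rR {N : ℕ} {Ω : Set (EuclN N)} (hI : NInv Ω) {a b : EuclN N} (h : OP a b) (θ : ℝ) {x : EuclN N}
    (hx : x ∈ Ω) : rR a b θ x ∈ Ω := hI x hx _ (rR_norm h θ x)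

lemma NInv.frontier {N : ℕ} {Ω : Set (EuclN N)} (hI : NInv Ω) {a b : EuclN N} (h : OP a b) (θ : ℝ) {x : EuclN N}
    (hx : x ∈ frontier Ω) : _root_.rR a b θ x ∈ frontier Ω := by
  have e : (rI h θ).toHomeomorph ⁻¹' Ω = Ω := by
    ext y
    refine ⟨fun hy => hI _ hy y ?_, fun hy => hI.rR h θ hy⟩
    exact (rR_norm h θ y).symm
  have := (rI h θ).toHomeomorph.preimage_frontier Ω
  rw [e] at this
  rw [← this] at hx
  exact hx

open Classical in
noncomputable def rV {N : ℕ} (Ω : Set (EuclN N)) (a b : EuclN N) (u : EuclN N → ℝ) (x : EuclN N) : ℝ :=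
  if x ∈ Ω then fderiv ℝ u x (rA a b x) else 0

lemma rV_C1 {N : ℕ} {Ω : Set (EuclN N)} (hΩ : IsOpen Ω) (a b : EuclN N) {u : EuclN N → ℝ}
    (hu : ContDiffOn ℝ 2 u Ω) : ContDiffOn ℝ 1 (rV Ω a b u) Ω := by
  have h1 : ContDiffOn ℝ 1 (fderiv ℝ u) Ω := hu.fderiv_of_isOpen hΩ (by norm_num)
  have h2 : ContDiffOn ℝ 1 (fun x => fderiv ℝ u x (rA a b x)) Ω :=
    h1.clm_apply (rA a b).contDiff.contDiffOn
  exact h2.congr fun x hx => by simp [rV, hx]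

lemma rV_cont {N : ℕ} {Ω : Set (EuclN N)} (hΩ : IsOpen Ω) (hI : NInv Ω) {a b : EuclN N} (h : OP a b)
    {u : EuclN N → ℝ}
    (hu : ContDiffOn ℝ 2 u Ω) (hu1 : ContDiffOn ℝ 1 u (closure Ω)) (hu0 : ∀ x ∈ frontier Ω, u x = 0) :
    Continuous (rV Ω a b u) := by
  rw [continuous_iff_continuousAt]
  intro x
  by_cases hx : x ∈ Ω
  · exact (rV_C1 hΩ a b hu).continuousOn.continuousAt (hΩ.mem_nhds hx)
  have hvx : rV Ω a b u x = 0 := by simp [rV, hx]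
  rw [ContinuousAt, hvx]
  by_cases hc : x ∈ closure Ω
  swap
  · refine tendsto_const_nhds.congr' ?_
    filter_upwards [isClosed_closure.isOpen_compl.mem_nhds hc] with y hy
    have : y ∉ Ω := fun h => hy (subset_closure h)
    simp [rV, this]
  have hfr : x ∈ frontier Ω := ⟨hc, fun h => hx (interior_subset h)⟩
  have hcd : ContDiffWithinAt ℝ ((0 : ℕ) + 1) u (closure Ω) x := by simpa using hu1 x hc
  obtain ⟨s, hs, hss, -, f', hf', hf'c⟩ := (contDiffWithinAt_succ_iff_hasFDerivWithinAt' (by simp)).1 hcd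
  rw [insert_eq_of_mem hc] at hs hss
  have hf0 := hf'c.continuousWithinAt
  have hxs : x ∈ s := mem_of_mem_nhdsWithin hc hs
  have hz : f' x (rA a b x) = 0 := by
    have d0 := rR_deriv h 0 x
    rw [rR_zero] at d0
    have : HasDerivAt (u ∘ fun t => rR a b t x) (f' x (rA a b x)) 0 := by
      have d1 : HasFDerivWithinAt u (f' x) (closure Ω) (rR a b 0 x) := by
        rw [rR_zero]; exact hf' x hxs
      have := d1.comp_hasDerivWithinAt (s := univ) 0 d0.hasDerivWithinAt
        (fun t _ => frontier_subset_closure (hI.frontier h t hfr))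
      exact hasDerivWithinAt_univ.1 this
    have e : (u ∘ fun t => rR a b t x) = fun _ => 0 := by
      funext t; exact hu0 _ (hI.frontier h t hfr)
    rw [e] at this
    exact this.unique (hasDerivAt_const _ _)
  have hsplit : 𝓝 x = 𝓝[Ω] x ⊔ 𝓝[Ωᶜ] x := by rw [← nhdsWithin_union]; simp
  rw [hsplit, tendsto_sup]
  constructor
  · have t1 : Tendsto f' (𝓝[Ω] x) (𝓝 (f' x)) := by
      refine hf0.mono_left ?_
      exact nhdsWithin_mono x subset_closure
    have t2 : Tendsto (fun y => rA a b y) (𝓝[Ω] x) (𝓝 (rA a b x)) :=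
      ((rA a b).continuous.tendsto x).mono_left nhdsWithin_le_nhds
    have t3 : Tendsto (fun y => f' y (rA a b y)) (𝓝[Ω] x) (𝓝 (f' x (rA a b x))) :=
      ((isBoundedBilinearMap_apply (𝕜 := ℝ) (E := EuclN N) (F := ℝ)).continuous.tendsto
        (f' x, rA a b x)).comp (t1.prodMk_nhds t2)
    rw [hz] at t3
    refine t3.congr' ?_
    have : s ∈ 𝓝[Ω] x := nhdsWithin_mono x subset_closure hs
    filter_upwards [this, self_mem_nhdsWithin] with y hy hyΩ
    have : HasFDerivAt u (f' y) y := (hf' y hy).hasFDerivAt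
      (mem_of_superset (hΩ.mem_nhds hyΩ) subset_closure)
    simp [rV, hyΩ, this.fderiv]
  · refine tendsto_const_nhds.congr' ?_
    filter_upwards [self_mem_nhdsWithin] with y hy
    have : y ∉ Ω := hy
    simp [rV, this]

lemma pd_eq {m : ℕ} {f : ℝ → (Fin m → ℝ) → ℝ} (hf : ContDiff ℝ 1 (fun q : ℝ × (Fin m → ℝ) => f q.1 q.2))
    (j : Fin m) (r : ℝ) (s : Fin m → ℝ) :
    pd f j r s = fderiv ℝ (fun q : ℝ × (Fin m → ℝ) => f q.1 q.2) (r, s) (0, Pi.single j 1) := by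
  have h1 := (hf.differentiable (by norm_num) (r, s)).hasFDerivAt
  have h2 : HasFDerivAt (fun s : Fin m → ℝ => (r, s)) (ContinuousLinearMap.inr ℝ ℝ (Fin m → ℝ)) s :=
    hasFDerivAt_prodMk_right r s
  have := (h1.comp s h2).fderiv
  unfold pd
  rw [show f r = (fun q : ℝ × (Fin m → ℝ) => f q.1 q.2) ∘ (fun s : Fin m → ℝ => (r, s)) from rfl, this]
  simp

lemma pd_cont {m : ℕ} {f : ℝ → (Fin m → ℝ) → ℝ} (hf : ContDiff ℝ 1 (fun q : ℝ × (Fin m → ℝ) => f q.1 q.2))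
    (j : Fin m) : Continuous (fun q : ℝ × (Fin m → ℝ) => pd f j q.1 q.2) := by
  have := hf.continuous_fderiv (by norm_num)
  simp_rw [pd_eq hf]
  fun_prop

end

section
open MeasureTheory Real Set
open scoped RealInnerProductSpace ENNReal
open scoped Topology
open Filter

lemma fderiv_grad {N : ℕ} (u g : EuclN N → ℝ) (x : EuclN N) :
    fderiv ℝ u x (gradient g x) = ∑ k, pD k u x * pD k g x := by
  conv_lhs => rw [show gradient g x = ∑ k, (gradient g x) k • EuclideanSpace.single k (1:ℝ) from by
      ext j; simp [Finset.sum_apply, Pi.single_apply]]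
  rw [map_sum]
  refine Finset.sum_congr rfl fun k _ => ?_
  rw [map_smul, gradient_apply', smul_eq_mul, mul_comm]; rfl

lemma grad_rot {N : ℕ} {a b : EuclN N} (h : OP a b) (θ : ℝ) {φ : EuclN N → ℝ} (hφ : ContDiff ℝ 1 φ)
    (y : EuclN N) :
    gradient (fun x => φ (rR a b (-θ) x)) (rR a b θ y) = rR a b θ (gradient φ y) := by
  refine ext_inner_right ℝ fun z => ?_
  rw [rR_inner]
  unfold gradient
  rw [InnerProductSpace.toDual_symm_apply, InnerProductSpace.toDual_symm_apply]
  have d : DifferentiableAt ℝ φ (rR a b (-θ) (rR a b θ y)) := hφ.differentiable (by norm_num) _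
  have := (d.hasFDerivAt.comp (rR a b θ y) (rR a b (-θ)).hasFDerivAt).fderiv
  rw [show (fun x => φ (rR a b (-θ) x)) = φ ∘ (rR a b (-θ)) from rfl, this, rR_inv h]
  rfl

lemma rot_weak {N : ℕ} {Ω : Set (EuclN N)} (hΩ : IsOpen Ω) (hI : NInv Ω) {a b : EuclN N} (h : OP a b)
    {u F : EuclN N → ℝ} (hu : ContDiffOn ℝ 2 u Ω) (hF : ∀ x ∈ Ω, - lap u x = F x)
    {φ : EuclN N → ℝ} (p1 : ContDiff ℝ 1 φ) (p2 : HasCompactSupport φ) (p3 : tsupport φ ⊆ Ω) (θ : ℝ) :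
    ∫ y in tsupport φ, fderiv ℝ u (rR a b θ y) (rR a b θ (gradient φ y)) =
      ∫ y in tsupport φ, F (rR a b θ y) * φ y := by
  have g1 : ContDiff ℝ 1 (fun x => φ (rR a b (-θ) x)) := p1.comp (rR a b (-θ)).contDiff
  have g2 : HasCompactSupport (fun x => φ (rR a b (-θ) x)) :=
    p2.comp_homeomorph (rI h (-θ)).toHomeomorph
  have g3 : tsupport (fun x => φ (rR a b (-θ) x)) ⊆ Ω := by
    have : tsupport (fun x => φ (rR a b (-θ) x)) ⊆ (rR a b (-θ)) ⁻¹' tsupport φ := by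
      refine closure_minimal ?_ ((isClosed_tsupport φ).preimage (rR a b (-θ)).continuous)
      intro x hx
      exact subset_tsupport φ hx
    intro x hx
    exact hI _ (p3 (this hx)) x (rR_norm h _ x).symm
  have w := weak_form hΩ hu hF g1 g2 g3
  have mp := (rI h θ).measurePreserving
  have c1 := mp.integral_comp' (f := (rI h θ).toHomeomorph.toMeasurableEquiv)
    (fun x => fderiv ℝ u x (gradient (fun x => φ (rR a b (-θ) x)) x))
  have c2 := mp.integral_comp' (f := (rI h θ).toHomeomorph.toMeasurableEquiv)
    (fun x => F x * (φ (rR a b (-θ) x)))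
  rw [← c1, ← c2] at w
  have e1 : ∀ y, (rI h θ).toHomeomorph.toMeasurableEquiv y = rR a b θ y := fun y => rfl
  simp only [e1, grad_rot h θ p1, rR_inv h] at w
  rw [setIntegral_eq_integral_of_forall_compl_eq_zero, setIntegral_eq_integral_of_forall_compl_eq_zero]
  · exact w
  · intro x hx
    rw [image_eq_zero_of_notMem_tsupport hx, mul_zero]
  · intro x hx
    have : gradient φ x = 0 := by
      ext k
      rw [gradient_apply']
      have : x ∉ tsupport (pD k φ) := fun h => hx (pD_supp k h)
      rw [image_eq_zero_of_notMem_tsupport this]; rfl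
    simp [this]

lemma rV_fderiv {N : ℕ} {Ω : Set (EuclN N)} (hΩ : IsOpen Ω) (a b : EuclN N)
    {u : EuclN N → ℝ} (hu : ContDiffOn ℝ 2 u Ω) {x : EuclN N} (hx : x ∈ Ω) (X : EuclN N) :
    fderiv ℝ (rV Ω a b u) x X =
      fderiv ℝ (fderiv ℝ u) x (rA a b x) X + fderiv ℝ u x (rA a b X) := by
  have ev : rV Ω a b u =ᶠ[𝓝 x] fun x => fderiv ℝ u x (rA a b x) := by
    filter_upwards [hΩ.mem_nhds hx] with y hy
    simp [rV, hy]
  have cd := hu.contDiffAt (hΩ.mem_nhds hx)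
  have h1 : DifferentiableAt ℝ (fderiv ℝ u) x := by
    have : ContDiffAt ℝ 1 (fderiv ℝ u) x := cd.fderiv_right (by norm_num)
    exact this.differentiableAt (by norm_num)
  rw [ev.fderiv_eq, (h1.hasFDerivAt.clm_apply (rA a b).hasFDerivAt).fderiv]
  have sy : IsSymmSndFDerivAt ℝ u x := cd.isSymmSndFDerivAt (by simp)
  simp [sy.eq X (rA a b x), add_comm]

set_option maxHeartbeats 4000000 in
lemma rV_weak {N m : ℕ} {Ω : Set (EuclN N)} (hΩ : IsOpen Ω) (hI : NInv Ω) {a b : EuclN N} (h : OP a b)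
    {f : Fin m → ℝ → (Fin m → ℝ) → ℝ}
    (hf : ∀ i, ContDiff ℝ 1 (fun q : ℝ × (Fin m → ℝ) => f i q.1 q.2))
    {U : Fin m → EuclN N → ℝ} (hU : ∀ i, ContDiffOn ℝ 2 (U i) Ω)
    (hs : ∀ i, ∀ x ∈ Ω, -lap (U i) x = f i ‖x‖ (fun k => U k x)) (i : Fin m)
    {φ : EuclN N → ℝ} (p1 : ContDiff ℝ 1 φ) (p2 : HasCompactSupport φ) (p3 : tsupport φ ⊆ Ω) :
    ∫ x, ∑ k, pD k (rV Ω a b (U i)) x * pD k φ x =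
      ∫ x, (∑ j, pd (f i) j ‖x‖ (fun k => U k x) * rV Ω a b (U j) x) * φ x := by
  have hK : IsCompact (tsupport φ) := p2
  have key := rot_weak hΩ hI h (hU i) (hs i) p1 p2 p3
  have cgr : Continuous (gradient φ) := by
    have : Continuous (fderiv ℝ φ) := p1.continuous_fderiv (by norm_num)
    unfold gradient
    exact (InnerProductSpace.toDual ℝ (EuclN N)).symm.continuous.comp this
  have hC := rR_cont a b
  have hCt : ∀ t, Continuous (fun x => rR a b t x) := fun t => (rR a b t).continuous
  have mapsto : MapsTo (fun p : ℝ × EuclN N => rR a b p.1 p.2) (univ ×ˢ tsupport φ) Ω :=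
    fun p hp => hI.rR h _ (p3 hp.2)
  have hD1 : ∀ j, ContinuousOn (fderiv ℝ (U j)) Ω := fun j =>
    (hU j).continuousOn_fderiv_of_isOpen hΩ (by norm_num)
  have hD1' : ∀ j, ContDiffOn ℝ 1 (fderiv ℝ (U j)) Ω := fun j => (hU j).fderiv_of_isOpen hΩ (by norm_num)
  have hD2 : ∀ j, ContinuousOn (fderiv ℝ (fderiv ℝ (U j))) Ω := fun j =>
    (hD1' j).continuousOn_fderiv_of_isOpen hΩ (by norm_num)
  have cX : Continuous (fun p : ℝ × EuclN N => rR a b p.1 (gradient φ p.2)) := by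
    simp only [rR_apply]
    fun_prop
  have cU1 : ∀ j, ContinuousOn (fun p : ℝ × EuclN N => fderiv ℝ (U j) (rR a b p.1 p.2)) (univ ×ˢ tsupport φ) :=
    fun j => (hD1 j).comp hC.continuousOn mapsto
  have cU2 : ∀ j, ContinuousOn (fun p : ℝ × EuclN N => fderiv ℝ (fderiv ℝ (U j)) (rR a b p.1 p.2)) (univ ×ˢ tsupport φ) :=
    fun j => (hD2 j).comp hC.continuousOn mapsto
  have cA : Continuous (fun p : ℝ × EuclN N => rA a b (rR a b p.1 p.2)) := (rA a b).continuous.comp hC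
  have cAX : Continuous (fun p : ℝ × EuclN N => rA a b (rR a b p.1 (gradient φ p.2))) :=
    (rA a b).continuous.comp cX
  have cUU : ContinuousOn (fun p : ℝ × EuclN N => fun k => U k (rR a b p.1 p.2)) (univ ×ˢ tsupport φ) :=
    continuousOn_pi.2 fun k => ((hU k).continuousOn).comp hC.continuousOn mapsto
  have sec : ∀ {β : Type} [TopologicalSpace β] (F : ℝ × EuclN N → β), ContinuousOn F (univ ×ˢ tsupport φ) →
      ∀ t, ContinuousOn (fun x => F (t, x)) (tsupport φ) := by
    intro β _ F hF t
    exact hF.comp (by fun_prop) (fun x hx => ⟨trivial, hx⟩)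
  have L := deriv_under hK (fun t y => fderiv ℝ (U i) (rR a b t y) (rR a b t (gradient φ y)))
    (fun t y => fderiv ℝ (fderiv ℝ (U i)) (rR a b t y) (rA a b (rR a b t y)) (rR a b t (gradient φ y))
      + fderiv ℝ (U i) (rR a b t y) (rA a b (rR a b t (gradient φ y))))
    (sec (fun p => fderiv ℝ (U i) (rR a b p.1 p.2) (rR a b p.1 (gradient φ p.2))) ((cU1 i).clm_apply cX.continuousOn))
    ((((cU2 i).clm_apply cA.continuousOn).clm_apply cX.continuousOn).add
      ((cU1 i).clm_apply cAX.continuousOn))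
    (by
      intro x hx t
      have d1 := rR_deriv h t x
      have d2 := rR_deriv h t (gradient φ x)
      have d3 : HasFDerivAt (fderiv ℝ (U i)) (fderiv ℝ (fderiv ℝ (U i)) (rR a b t x)) (rR a b t x) :=
        (((hD1' i).contDiffAt (hΩ.mem_nhds (hI.rR h t (p3 hx)))).differentiableAt (by norm_num)).hasFDerivAt
      exact (d3.comp_hasDerivAt t d1).clm_apply d2) 0
  have Rr := deriv_under hK (fun t y => f i ‖rR a b t y‖ (fun k => U k (rR a b t y)) * φ y)
    (fun t y => (∑ j, pd (f i) j ‖y‖ (fun k => U k (rR a b t y)) *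
      fderiv ℝ (U j) (rR a b t y) (rA a b (rR a b t y))) * φ y)
    (sec (fun p => f i ‖rR a b p.1 p.2‖ (fun k => U k (rR a b p.1 p.2)) * φ p.2)
      (((hf i).continuous.comp_continuousOn (hC.norm.continuousOn.prodMk cUU)).mul
        (p1.continuous.comp continuous_snd).continuousOn))
    ((continuousOn_finsetSum _ fun j _ => ((pd_cont (hf i) j).comp_continuousOn
      (continuous_snd.norm.continuousOn.prodMk cUU)).mul ((cU1 j).clm_apply cA.continuousOn)).mul
        (p1.continuous.comp continuous_snd).continuousOn)
    (by
      intro x hx t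
      simp only [rR_norm h]
      refine HasDerivAt.mul_const ?_ _
      have d1 := rR_deriv h t x
      have d2 : HasDerivAt (fun t => fun k => U k (rR a b t x))
          (fun k => fderiv ℝ (U k) (rR a b t x) (rA a b (rR a b t x))) t := by
        rw [hasDerivAt_pi]
        intro k
        have d3 : HasFDerivAt (U k) (fderiv ℝ (U k) (rR a b t x)) (rR a b t x) :=
          (((hU k).contDiffAt (hΩ.mem_nhds (hI.rR h t (p3 hx)))).differentiableAt (by norm_num)).hasFDerivAt
        exact d3.comp_hasDerivAt t d1
      have d4 : HasFDerivAt (f i ‖x‖) (fderiv ℝ (f i ‖x‖) (fun k => U k (rR a b t x)))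
          (fun k => U k (rR a b t x)) := by
        have : Differentiable ℝ (f i ‖x‖) :=
          ((hf i).differentiable (by norm_num)).comp (g := fun q : ℝ × (Fin m → ℝ) => f i q.1 q.2)
            (f := fun s => (‖x‖, s)) (by fun_prop)
        exact (this _).hasFDerivAt
      have d5 := d4.comp_hasDerivAt t d2
      refine d5.congr_deriv ?_
      rw [pi_eq_sum_univ' (fun k => fderiv ℝ (U k) (rR a b t x) (rA a b (rR a b t x))), map_sum]
      refine Finset.sum_congr rfl fun j _ => ?_
      rw [map_smul, smul_eq_mul, mul_comm]
      unfold pd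
      congr 2) 0
  rw [show (fun t => ∫ y in tsupport φ, fderiv ℝ (U i) (rR a b t y) (rR a b t (gradient φ y))) = _ from
    funext key] at L
  have := L.unique Rr
  simp only [rR_zero] at this
  have s1 : ∫ x, ∑ k, pD k (rV Ω a b (U i)) x * pD k φ x =
      ∫ x in tsupport φ, ∑ k, pD k (rV Ω a b (U i)) x * pD k φ x := by
    rw [setIntegral_eq_integral_of_forall_compl_eq_zero]
    intro x hx
    refine Finset.sum_eq_zero fun k _ => ?_
    rw [image_eq_zero_of_notMem_tsupport (f := pD k φ) (fun h => hx (pD_supp k h)), mul_zero]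
  have s2 : ∫ x, (∑ j, pd (f i) j ‖x‖ (fun k => U k x) * rV Ω a b (U j) x) * φ x =
      ∫ x in tsupport φ, (∑ j, pd (f i) j ‖x‖ (fun k => U k x) * rV Ω a b (U j) x) * φ x := by
    rw [setIntegral_eq_integral_of_forall_compl_eq_zero]
    intro x hx
    rw [image_eq_zero_of_notMem_tsupport hx, mul_zero]
  rw [s1, s2]
  refine Eq.trans (setIntegral_congr_fun (isClosed_tsupport φ).measurableSet fun x hx => ?_)
    (this.trans (setIntegral_congr_fun (isClosed_tsupport φ).measurableSet fun x hx => ?_))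
  · rw [← fderiv_grad, rV_fderiv hΩ a b (hU i) (p3 hx)]
  · simp [rV, p3 hx]

end

section
open MeasureTheory Real Set
open scoped RealInnerProductSpace ENNReal
open scoped Topology
open Filter

lemma ba_props {N : ℕ} {Ω : Set (EuclN N)} (h : IsBallOrAnnulus Ω) :
    IsOpen Ω ∧ Bornology.IsBounded Ω ∧ NInv Ω := by
  rcases h with ⟨R, hR, rfl⟩ | ⟨r, R, hr, hR, rfl⟩
  · refine ⟨Metric.isOpen_ball, Metric.isBounded_ball, ?_⟩
    intro x hx y hy
    simpa [hy] using hx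
  · refine ⟨(isOpen_lt continuous_const continuous_norm).inter (isOpen_lt continuous_norm continuous_const), ?_, ?_⟩
    · refine (Metric.isBounded_ball (x := (0 : EuclN N)) (r := R)).subset fun x hx => ?_
      simpa using hx.2
    · intro x hx y hy
      simpa [hy] using hx

lemma J_bound {N m : ℕ} {Ω : Set (EuclN N)} (hb : Bornology.IsBounded Ω)
    (J : Fin m → Fin m → EuclN N → ℝ) (hJ : ∀ i j, ContinuousOn (J i j) (closure Ω)) :
    ∃ K : ℝ, 0 ≤ K ∧ ∀ i j, ∀ x ∈ Ω, |J i j x| ≤ K := by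
  have : ∀ i j, ∃ B : ℝ, ∀ x ∈ Ω, |J i j x| ≤ B := by
    intro i j
    obtain ⟨B, hB⟩ := hb.isCompact_closure.exists_bound_of_continuousOn (hJ i j)
    exact ⟨B, fun x hx => hB x (subset_closure hx)⟩
  choose B hB using this
  refine ⟨∑ i, ∑ j, |B i j|, Finset.sum_nonneg fun i _ => Finset.sum_nonneg fun j _ => abs_nonneg _, ?_⟩
  intro i j x hx
  refine (hB i j x hx).trans ((le_abs_self _).trans ?_)
  refine (Finset.single_le_sum (f := fun j => |B i j|) (fun j _ => abs_nonneg _) (Finset.mem_univ j)).trans ?_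
  exact Finset.single_le_sum (f := fun i => ∑ j, |B i j|)
    (fun i _ => Finset.sum_nonneg fun j _ => abs_nonneg _) (Finset.mem_univ i)

lemma orbit {N : ℕ} {Ω : Set (EuclN N)} (hΩ : IsOpen Ω) (hI : NInv Ω) {a b : EuclN N} (h : OP a b)
    {u v : EuclN N → ℝ} (hu : DifferentiableOn ℝ u Ω) (hv : Continuous v)
    (huv : ∀ x ∈ Ω, v x = fderiv ℝ u x (rA a b x))
    (hloc : ∀ x ∈ Ω, v x ≤ 0 → ∀ᶠ y in 𝓝 x, v y ≤ 0) (x : EuclN N) (hx : x ∈ Ω) : v x ≤ 0 := by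
  by_contra hpos
  push Not at hpos
  have cγ : Continuous (fun θ : ℝ => rR a b θ x) :=
    continuous_iff_continuousAt.2 fun θ => (rR_deriv h θ x).continuousAt
  have cl : IsClopen {θ : ℝ | 0 < v (rR a b θ x)} := by
    constructor
    · rw [← isOpen_compl_iff, isOpen_iff_mem_nhds]
      intro θ hθ
      have := cγ.continuousAt.eventually (hloc _ (hI.rR h θ hx) (not_lt.1 hθ))
      filter_upwards [this] with t ht
      simpa using ht
    · exact isOpen_lt continuous_const (hv.comp cγ)
  have hne : {θ : ℝ | 0 < v (rR a b θ x)}.Nonempty := ⟨0, by simpa [rR_zero] using hpos⟩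
  have hall := cl.eq_univ hne
  have sm : StrictMono (fun θ => u (rR a b θ x)) := by
    refine strictMono_of_deriv_pos fun θ => ?_
    have hm := hI.rR h θ hx
    have d3 : HasFDerivAt u (fderiv ℝ u (rR a b θ x)) (rR a b θ x) :=
      (hu.differentiableAt (hΩ.mem_nhds hm)).hasFDerivAt
    have d4 := (d3.comp_hasDerivAt θ (rR_deriv h θ x)).deriv
    have : θ ∈ {θ : ℝ | 0 < v (rR a b θ x)} := by rw [hall]; trivial
    have this2 : 0 < v (rR a b θ x) := this
    rw [huv _ hm] at this2
    rw [show (fun θ => u (rR a b θ x)) = u ∘ fun θ => rR a b θ x from rfl, d4]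
    exact this2
  have := sm (show (0:ℝ) < 2 * π by positivity)
  simp [rR_zero, rR_two_pi] at this

lemma loc_zero {N m : ℕ} {Ω : Set (EuclN N)} (hΩ : IsOpen Ω) (hb : Bornology.IsBounded Ω)
    (J : Fin m → Fin m → EuclN N → ℝ) (hJ : ∀ i j, ContinuousOn (J i j) (closure Ω))
    (hJ0 : ∀ i j, i ≠ j → ∀ x ∈ Ω, 0 ≤ J i j x)
    (V : Fin m → EuclN N → ℝ) (hV : ∀ i, Continuous (V i)) (hV0 : ∀ i, ∀ x ∉ Ω, V i x = 0)
    (hV1 : ∀ i, ContDiffOn ℝ 1 (V i) Ω)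
    (hw : ∀ i, ∀ φ : EuclN N → ℝ, ContDiff ℝ 1 φ → HasCompactSupport φ → tsupport φ ⊆ Ω →
      ∫ x, ∑ k, pD k (V i) x * pD k φ x = ∫ x, (∑ j, J i j x * V j x) * φ x)
    (hst : ∀ Ψ : Fin m → EuclN N → ℝ, IsTestFun Ω Ψ →
      0 ≤ ∫ x in Ω, ((∑ i, ‖gradient (Ψ i) x‖ ^ 2) - ∑ i, ∑ j, J i j x * Ψ i x * Ψ j x))
    (i : Fin m) (x : EuclN N) (hx : x ∈ Ω) (hvx : V i x ≤ 0) : ∀ᶠ y in 𝓝 x, V i y ≤ 0 := by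
  obtain ⟨K, hK, hJK⟩ := J_bound hb J hJ
  obtain ⟨S, hS, hSb⟩ := Metric.nhds_basis_closedBall.mem_iff.1 (hΩ.mem_nhds hx)
  have mv := meanvalue (fun x => max 0 (V i x)) (continuous_const.max (hV i))
    (fun x => le_max_left _ _) K hK
    (fun φ p1 p2 p3 p0 p4 => core hΩ hb J (fun i j => (hJ i j).mono subset_closure) K hK hJK hJ0
      V hV hV0 hV1 hw hst i p1 p2 p3 p0 p4) x (max_eq_left hvx) S hSb
  filter_upwards [Metric.ball_mem_nhds x hS] with y hy
  have h1 := mv y hy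
  have h2 : V i y ≤ max 0 (V i y) := le_max_right _ _
  linarith

lemma rV_nonpos
    {N m : ℕ} {Ω : Set (EuclN N)} (hΩ : IsOpen Ω) (hb : Bornology.IsBounded Ω) (hI : NInv Ω)
    (f : Fin m → ℝ → (Fin m → ℝ) → ℝ)
    (hf : ∀ i, ContDiff ℝ 1 (fun q : ℝ × (Fin m → ℝ) => f i q.1 q.2))
    (U : Fin m → EuclN N → ℝ)
    (hUreg : ∀ i, ContDiffOn ℝ 2 (U i) Ω ∧ ContDiffOn ℝ 1 (U i) (closure Ω))
    (hsol : IsSolution Ω f U)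
    (hstable : ∀ Ψ : Fin m → EuclN N → ℝ, IsTestFun Ω Ψ → 0 ≤ Qform f U Ω Ψ)
    (hcoop : CoopAlong f Ω) {a b : EuclN N} (h : OP a b) (i : Fin m) (x : EuclN N) (hx : x ∈ Ω) :
    rV Ω a b (U i) x ≤ 0 := by
  have hcU : ContinuousOn (fun x => fun k => U k x) (closure Ω) :=
    continuousOn_pi.2 fun k => (hUreg k).2.continuousOn
  have hJc : ∀ i j, ContinuousOn (fun x => pd (f i) j ‖x‖ (fun k => U k x)) (closure Ω) :=
    fun i j => (pd_cont (hf i) j).comp_continuousOn (continuous_norm.continuousOn.prodMk hcU)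
  have hVc : ∀ j, Continuous (rV Ω a b (U j)) := fun j =>
    rV_cont hΩ hI h (hUreg j).1 (hUreg j).2 (hsol.2 j)
  have hV0 : ∀ j, ∀ x ∉ Ω, rV Ω a b (U j) x = 0 := fun j x hx => by simp [rV, hx]
  refine orbit hΩ hI h ((hUreg i).1.differentiableOn (by norm_num)) (hVc i)
    (fun x hx => by simp [rV, hx]) ?_ x hx
  exact loc_zero hΩ hb (fun i j x => pd (f i) j ‖x‖ (fun k => U k x)) hJc
      (fun i j hij x hx => hcoop i j hij x hx _) (fun j => rV Ω a b (U j)) hVc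
      hV0 (fun j => rV_C1 hΩ a b (hUreg j).1)
      (fun j φ q1 q2 q3 => rV_weak hΩ hI h hf (fun j => (hUreg j).1) hsol.1 j q1 q2 q3)
      hstable i

lemma exists_rot {N : ℕ} (hN : 2 ≤ N) {x y : EuclN N} (hxy : ‖x‖ = ‖y‖) (hx : x ≠ 0) :
    ∃ a b : EuclN N, OP a b ∧ ∃ θ, rR a b θ x = y := by
  set r := ‖x‖ with hr
  have hr0 : 0 < r := norm_pos_iff.2 hx
  obtain ⟨a, ha⟩ : ∃ a, a = r⁻¹ • x := ⟨_, rfl⟩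
  have ha1 : ‖a‖ = 1 := by
    rw [ha, norm_smul, norm_inv, norm_norm]; exact inv_mul_cancel₀ hr0.ne'
  have hxa : x = r • a := by rw [ha, smul_smul, mul_inv_cancel₀ hr0.ne', one_smul]
  have haa : ⟪a, a⟫ = 1 := by rw [real_inner_self_eq_norm_sq, ha1]; norm_num
  have hb : ∃ b : EuclN N, OP a b ∧ y = ⟪a, y⟫ • a + ⟪b, y⟫ • b := by
    by_cases hz : y - ⟪a, y⟫ • a = 0
    · have : Nontrivial ((Submodule.span ℝ {a})ᗮ : Submodule ℝ (EuclN N)) := by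
        obtain ⟨n, rfl⟩ : ∃ n, N = n + 1 := ⟨N - 1, by omega⟩
        have : Fact (Module.finrank ℝ (EuclN (n + 1)) = n + 1) := ⟨by simp⟩
        have hf := Submodule.finrank_orthogonal_span_singleton (𝕜 := ℝ) (n := n) (v := a) (by
          intro h; rw [h] at ha1; simp at ha1)
        apply Module.nontrivial_of_finrank_pos (R := ℝ)
        rw [hf]; omega
      obtain ⟨⟨c, hc⟩, hc0⟩ := exists_ne (0 : ((Submodule.span ℝ {a})ᗮ : Submodule ℝ (EuclN N)))
      have hc0' : c ≠ 0 := fun h => hc0 (by ext1; exact h)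
      have hac : ⟪a, c⟫ = 0 := Submodule.mem_orthogonal_singleton_iff_inner_right.1 hc
      have hab : ⟪a, ‖c‖⁻¹ • c⟫ = 0 := by rw [inner_smul_right, hac, mul_zero]
      refine ⟨‖c‖⁻¹ • c, ⟨ha1, ?_, hab⟩, ?_⟩
      · rw [norm_smul, norm_inv, norm_norm, inv_mul_cancel₀ (norm_ne_zero_iff.2 hc0')]
      · have hy : y = ⟪a, y⟫ • a := sub_eq_zero.1 hz
        have : ⟪‖c‖⁻¹ • c, y⟫ = 0 := by
          have hh := congrArg (fun w => ⟪‖c‖⁻¹ • c, w⟫) hy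
          rw [hh, inner_smul_right, real_inner_comm a, hab, mul_zero]
        rw [this, zero_smul, add_zero]; exact hy
    · obtain ⟨z, hzd⟩ : ∃ z, z = y - ⟪a, y⟫ • a := ⟨_, rfl⟩
      rw [← hzd] at hz
      have haz : ⟪a, z⟫ = 0 := by
        rw [hzd, inner_sub_right, inner_smul_right, haa]; ring
      have hzy : ⟪z, y⟫ = ‖z‖ ^ 2 := by
        have : y = z + ⟪a, y⟫ • a := by rw [hzd]; abel
        have hh := congrArg (fun w => ⟪z, w⟫) this
        rw [hh, inner_add_right, inner_smul_right, real_inner_comm a z, haz, real_inner_self_eq_norm_sq]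
        simp
      have hz1 : ‖z‖ ≠ 0 := norm_ne_zero_iff.2 hz
      refine ⟨‖z‖⁻¹ • z, ⟨ha1, ?_, ?_⟩, ?_⟩
      · rw [norm_smul, norm_inv, norm_norm, inv_mul_cancel₀ hz1]
      · rw [inner_smul_right, haz, mul_zero]
      · rw [inner_smul_left, hzy, smul_smul]
        have : (starRingEnd ℝ) ‖z‖⁻¹ * ‖z‖ ^ 2 * ‖z‖⁻¹ = 1 := by
          simp only [conj_trivial]
          field_simp
        rw [this, one_smul, hzd]; abel
  obtain ⟨b, hab, hy⟩ := hb
  obtain ⟨i1, i2, i3, i4⟩ := hab.inn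
  have hsum : ⟪a, y⟫ ^ 2 + ⟪b, y⟫ ^ 2 = r ^ 2 := by
    have : ⟪y, y⟫ = ⟪a, y⟫ ^ 2 + ⟪b, y⟫ ^ 2 := by
      have hh := congrArg (fun w => ⟪w, y⟫) hy
      rw [hh, inner_add_left, inner_smul_left, inner_smul_left]
      simp only [conj_trivial]
      ring
    rw [← this, real_inner_self_eq_norm_sq, hxy]
  have hnorm : ‖(⟨⟪a, y⟫, ⟪b, y⟫⟩ : ℂ)‖ = r := by
    have : ‖(⟨⟪a, y⟫, ⟪b, y⟫⟩ : ℂ)‖ ^ 2 = r ^ 2 := by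
      rw [Complex.sq_norm, Complex.normSq_mk, ← hsum]; ring
    exact (pow_left_inj₀ (norm_nonneg _) hr0.le two_ne_zero).1 this
  have hne : (⟨⟪a, y⟫, ⟪b, y⟫⟩ : ℂ) ≠ 0 := by
    intro h; rw [h] at hnorm; simp at hnorm; linarith
  refine ⟨a, b, hab, Complex.arg ⟨⟪a, y⟫, ⟪b, y⟫⟩, ?_⟩
  rw [rR_apply, rA_sq hab, rA_apply, Complex.cos_arg hne, Complex.sin_arg, hnorm]
  have e1 : ⟪a, x⟫ = r := by rw [hxa, inner_smul_right, i1, mul_one]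
  have e2 : ⟪b, x⟫ = 0 := by rw [hxa, inner_smul_right, i4, mul_zero]
  rw [e1, e2]
  conv_rhs => rw [hy]
  conv_lhs => enter [1, 1]; rw [hxa]
  match_scalars
  · field_simp; ring
  · field_simp; try ring

lemma radial_main
    {N m : ℕ} (hN : 2 ≤ N)
    (Ω : Set (EuclN N)) (hΩ : IsBallOrAnnulus Ω)
    (f : Fin m → ℝ → (Fin m → ℝ) → ℝ)
    (hf : ∀ i, ContDiff ℝ 1 (fun q : ℝ × (Fin m → ℝ) => f i q.1 q.2))
    (U : Fin m → EuclN N → ℝ)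
    (hUreg : ∀ i, ContDiffOn ℝ 2 (U i) Ω ∧ ContDiffOn ℝ 1 (U i) (closure Ω))
    (hsol : IsSolution Ω f U)
    (hstable : ∀ Ψ : Fin m → EuclN N → ℝ, IsTestFun Ω Ψ → 0 ≤ Qform f U Ω Ψ)
    (hcoup : FullyCoupledAlong f U Ω) :
    IsRadial Ω U := by
  obtain ⟨ho, hb, hI⟩ := ba_props hΩ
  intro i x hx y hy hxy
  by_cases hx0 : x = 0
  · subst hx0
    have : y = 0 := by rw [norm_zero] at hxy; exact norm_eq_zero.1 hxy.symm
    rw [this]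
  obtain ⟨a, b, hab, θ, rfl⟩ := exists_rot hN hxy hx0
  have hba : OP b a := ⟨hab.2.1, hab.1, by rw [real_inner_comm]; exact hab.2.2⟩
  have hz : ∀ z ∈ Ω, fderiv ℝ (U i) z (rA a b z) = 0 := by
    intro z hz
    have h1 := rV_nonpos ho hb hI f hf U hUreg hsol hstable hcoup.1 hab i z hz
    have h2 := rV_nonpos ho hb hI f hf U hUreg hsol hstable hcoup.1 hba i z hz
    have e : rA b a z = - rA a b z := by rw [rA_apply, rA_apply]; abel
    simp only [rV, hz, if_true, e, map_neg] at h1 h2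
    linarith
  have hd : ∀ t, HasDerivAt (fun t => U i (rR a b t x)) 0 t := by
    intro t
    have hm := hI.rR hab t hx
    have d3 : HasFDerivAt (U i) (fderiv ℝ (U i) (rR a b t x)) (rR a b t x) :=
      (((hUreg i).1.contDiffAt (ho.mem_nhds hm)).differentiableAt (by norm_num)).hasFDerivAt
    have d4 := d3.comp_hasDerivAt t (rR_deriv hab t x)
    rw [hz _ hm] at d4
    exact d4
  have := is_const_of_deriv_eq_zero (fun t => (hd t).differentiableAt) (fun t => (hd t).deriv) 0 θ
  simpa [rR_zero] using this

end

/-- **Theorem.** A linearized stable solution of a system fully coupled along it is radial. -/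
theorem statement1
    {N m : ℕ} (hN : 2 ≤ N) (hm : 2 ≤ m)
    (Ω : Set (EuclN N)) (hΩ : IsBallOrAnnulus Ω)
    (f : Fin m → ℝ → (Fin m → ℝ) → ℝ)
    (hf : ∀ i, ContDiff ℝ 1 (fun q : ℝ × (Fin m → ℝ) => f i q.1 q.2))
    (U : Fin m → EuclN N → ℝ)
    (hUreg : ∀ i, ContDiffOn ℝ 2 (U i) Ω ∧ ContDiffOn ℝ 1 (U i) (closure Ω))
    (hsol : IsSolution Ω f U)
    (hstable : ∀ Ψ : Fin m → EuclN N → ℝ, IsTestFun Ω Ψ → 0 ≤ Qform f U Ω Ψ)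
    (hcoup : FullyCoupledAlong f U Ω) :
    IsRadial Ω U := by
  exact radial_main hN Ω hΩ f hf U hUreg hsol hstable hcoup
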